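/- Let L = {f_j} be a totally perfect sequence of holomorphic maps from the unit disk D into C^n and let {A_j} be a sequence of closed sets in D minus {0} such that the harmonic measures omega_j = omega(0, A_j, D) tend to 0 as j -> infinity. Let p_j be a holomorphic universal covering map of D_j = D minus A_j by D with p_j(0) = 0. Then the sequence L' = {f_j o p_j} is totally perfect, z_{L'} = z_L, cl L' = cl L, and mu_{L'} = mu_L. -/

import Mathlib

open MeasureTheory Metric Filter Topology Set Complex
open scoped ENNReal

noncomputable section

/-- `ℂⁿ`. -/
abbrev En (n : ℕ) : Type := EuclideanSpace ℂ (Fin n)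

instance (n : ℕ) : MeasurableSpace (En n) := borel _

instance (n : ℕ) : BorelSpace (En n) := ⟨rfl⟩

open Classical in
/-- The positive part of an extended real number, as an element of `ℝ≥0∞`. -/
def epos (x : EReal) : ℝ≥0∞ := if x = ⊤ then ⊤ else ENNReal.ofReal x.toReal

/-- The integral of an `EReal`-valued function `u` against a measure `μ`, defined as the
difference of the lower integrals of the positive and negative parts of `u`. -/
def eint {α : Type*} [MeasurableSpace α] (μ : Measure α) (u : α → EReal) : EReal :=
  ((∫⁻ x, epos (u x) ∂μ : ℝ≥0∞) : EReal) - ((∫⁻ x, epos (-(u x)) ∂μ : ℝ≥0∞) : EReal)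

/-- The normalized angular measure `(2π)⁻¹ dθ` on `[0, 2π)`. -/
def thetaM : Measure ℝ :=
  (ENNReal.ofReal ((2 * Real.pi)⁻¹)) • (volume.restrict (Set.Ico (0 : ℝ) (2 * Real.pi)))

/-- A function `u` with values in `[-∞, ∞)` is plurisubharmonic on an open set `U ⊆ ℂⁿ`:
it is upper semicontinuous, `< ⊤`, and satisfies the sub-mean-value inequality on every
complex line. -/
def PshOnE {n : ℕ} (u : En n → EReal) (U : Set (En n)) : Prop :=
  UpperSemicontinuousOn u U ∧ (∀ z ∈ U, u z < ⊤) ∧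
  ∀ z ∈ U, ∀ w : En n, ∀ r : ℝ, 0 < r →
    (∀ ζ : ℂ, ‖ζ‖ ≤ r → z + ζ • w ∈ U) →
    u z ≤ eint thetaM (fun θ => u (z + (circleMap 0 r θ) • w))

/-- `μ` is a Jensen measure on `X` with barycenter `z`:  a Borel probability measure
supported on `X` such that `u z ≤ ∫ u dμ` for every function `u` continuous and
plurisubharmonic on some open neighborhood of `X`. -/
def IsJensen {n : ℕ} (X : Set (En n)) (z : En n) (μ : Measure (En n)) : Prop :=
  IsProbabilityMeasure μ ∧ μ Xᶜ = 0 ∧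
  ∀ U : Set (En n), IsOpen U → X ⊆ U →
    ∀ u : En n → EReal, ContinuousOn u U → PshOnE u U → u z ≤ eint μ u

/-- `u : X → [-∞, ∞)` is plurisubharmonic on the compact set `X` : it is upper
semicontinuous on `X`, `< ⊤` on `X`, and satisfies the subaveraging inequality with respect
to all Jensen measures on `X`. -/
def PSHe {n : ℕ} (X : Set (En n)) (u : En n → EReal) : Prop :=
  UpperSemicontinuousOn u X ∧ (∀ z ∈ X, u z < ⊤) ∧
  ∀ z ∈ X, ∀ μ : Measure (En n), IsJensen X z μ → u z ≤ eint μ u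

/-- `PSH^c(X)`: continuous plurisubharmonic functions on `X`. -/
def PSHce {n : ℕ} (X : Set (En n)) (u : En n → EReal) : Prop :=
  PSHe X u ∧ ContinuousOn u X

/-- Real-valued continuous plurisubharmonic functions on `X`. -/
def PSHcR {n : ℕ} (X : Set (En n)) (u : En n → ℝ) : Prop :=
  ContinuousOn u X ∧ PSHe X (fun x => (u x : EReal))

/-- `O_X`: the set of points `z ∈ X` whose only Jensen measure is `δ_z`. -/
def Oset {n : ℕ} (X : Set (En n)) : Set (En n) :=
  {z | z ∈ X ∧ ∀ μ : Measure (En n), IsJensen X z μ → μ = Measure.dirac z}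

/-- The potential boundary `B_X`, the closure of `O_X`. -/
def Bset {n : ℕ} (X : Set (En n)) : Set (En n) := closure (Oset X)

/-- `J^b_z(X)`: Jensen measures with barycenter `z` supported on `B_X`. -/
def IsJensenB {n : ℕ} (X : Set (En n)) (z : En n) (μ : Measure (En n)) : Prop :=
  IsJensen X z μ ∧ μ (Bset X)ᶜ = 0

/-- `ν` is subordinated to `μ` : `μ(u) ≥ ν(u)` for all `u ∈ PSH^c(X)`. -/
def Subord {n : ℕ} (X : Set (En n)) (μ ν : Measure (En n)) : Prop :=
  ∀ u : En n → EReal, PSHce X u → eint ν u ≤ eint μ u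

/-- Subharmonic functions with values in `[-∞, ∞)` on an open set `U ⊆ ℂ`. -/
def SubharmOn (u : ℂ → EReal) (U : Set ℂ) : Prop :=
  UpperSemicontinuousOn u U ∧ (∀ z ∈ U, u z < ⊤) ∧
  ∀ z ∈ U, ∀ r : ℝ, 0 < r → closedBall z r ⊆ U →
    u z ≤ eint thetaM (fun θ => u (circleMap z r θ))

/-- Harmonic (real-valued) functions on an open set `U ⊆ ℂ`: continuous functions
satisfying the mean-value equality. -/
def HarmOn (h : ℂ → ℝ) (U : Set ℂ) : Prop :=
  ContinuousOn h U ∧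
  ∀ z ∈ U, ∀ r : ℝ, 0 < r → closedBall z r ⊆ U →
    h z = (2 * Real.pi)⁻¹ * ∫ θ in (0 : ℝ)..(2 * Real.pi), h (circleMap z r θ)

/-- Superharmonic (real-valued) functions on an open set `U ⊆ ℂ`. -/
def SuperharmOn (v : ℂ → ℝ) (U : Set ℂ) : Prop :=
  LowerSemicontinuousOn v U ∧
  ∀ z ∈ U, ∀ r : ℝ, 0 < r → closedBall z r ⊆ U →
    (2 * Real.pi)⁻¹ * (∫ θ in (0 : ℝ)..(2 * Real.pi), v (circleMap z r θ)) ≤ v z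

/-- The infimum of all positive superharmonic functions on the unit disk, extending
continuously to the closed disk and `≥ 1` on `A`, evaluated at `z`. -/
def hmPre (A : Set ℂ) (z : ℂ) : ℝ :=
  sInf {t : ℝ | ∃ v : ℂ → ℝ, SuperharmOn v (ball 0 1) ∧ (∀ w ∈ ball (0 : ℂ) 1, 0 < v w) ∧
    ContinuousOn v (closedBall 0 1) ∧ (∀ w ∈ A, 1 ≤ v w) ∧ t = v z}

/-- The harmonic measure `ω(z, A, 𝔻)` of `A` with respect to the unit disk. -/
def hm (z : ℂ) (A : Set ℂ) : ℝ := Filter.liminf (fun w => hmPre A w) (𝓝 z)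

open Classical in
/-- The radial limit of a map `f` at the boundary point `ζ` of the unit circle
(junk value `0` if the radial limit does not exist). -/
def bval {n : ℕ} (f : ℂ → En n) (ζ : ℂ) : En n :=
  if h : ∃ l : En n, Tendsto (fun r : ℝ => f ((r : ℂ) * ζ)) (𝓝[<] (1 : ℝ)) (𝓝 l)
  then h.choose else 0

open Classical in
/-- The radial limit of an `EReal`-valued function on the disk at the boundary point `ζ`. -/
def bvalE (g : ℂ → EReal) (ζ : ℂ) : EReal :=
  if h : ∃ l : EReal, Tendsto (fun r : ℝ => g ((r : ℂ) * ζ)) (𝓝[<] (1 : ℝ)) (𝓝 l)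
  then h.choose else 0

/-- `μ_f`: the push-forward of the normalized arclength measure on the unit circle under the
radial boundary values of `f`. -/
def bmeas {n : ℕ} (f : ℂ → En n) : Measure (En n) :=
  thetaM.map (fun θ => bval f (circleMap 0 1 θ))

/-- Weak-* convergence of a sequence of measures on `ℂⁿ`. -/
def WeakConv {n : ℕ} (μs : ℕ → Measure (En n)) (μ : Measure (En n)) : Prop :=
  ∀ φ : BoundedContinuousFunction (En n) ℝ,
    Tendsto (fun j => ∫ x, φ x ∂(μs j)) atTop (𝓝 (∫ x, φ x ∂μ))

/-- The cluster set `cl L` of a sequence of maps of the unit disk into `ℂⁿ`. -/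
def clusterSet {n : ℕ} (f : ℕ → ℂ → En n) : Set (En n) :=
  {z | ∀ r : ℝ, 0 < r → ∀ N : ℕ, ∃ j, N ≤ j ∧ ∃ ζ ∈ ball (0 : ℂ) 1, f j ζ ∈ ball z r}

/-- A point `z` is totally essential for the sequence `f` if for every open set `V ∋ z` the
harmonic measures at `0` of `f j ⁻¹' V` stay bounded away from `0`. -/
def TotallyEssential {n : ℕ} (f : ℕ → ℂ → En n) (z : En n) : Prop :=
  ∀ V : Set (En n), IsOpen V → z ∈ V →
    0 < Filter.atTop.liminf (fun j => hm 0 ((f j ⁻¹' V) ∩ ball 0 1))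

/-- A totally perfect sequence `L` of holomorphic maps of the unit disk into `ℂⁿ`: a
uniformly bounded sequence of holomorphic maps which is weak-* converging (with limit measure
`μ_L` and center `z_L`) and all of whose cluster points are totally essential. -/
structure PerfectSeq (n : ℕ) where
  f : ℕ → ℂ → En n
  holo : ∀ j, DifferentiableOn ℂ (f j) (ball 0 1)
  bdd : ∃ C : ℝ, ∀ j, ∀ ζ ∈ ball (0 : ℂ) 1, ‖f j ζ‖ ≤ C
  μL : Measure (En n)
  conv : WeakConv (fun j => bmeas (f j)) μL
  zL : En n
  center : Tendsto (fun j => f j 0) atTop (𝓝 zL)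
  ess : ∀ z ∈ clusterSet f, TotallyEssential f z

/-- `J_z^s(L)`: the measures obtained as weak-* limits of `μ_{f_{j_k} ∘ g_k}` for subsequences
`{j_k}` and holomorphic maps `g_k : 𝔻 → 𝔻` with `f_{j_k}(g_k(0)) → z`. -/
def JsSet {n : ℕ} (L : PerfectSeq n) (z : En n) : Set (Measure (En n)) :=
  {μ | ∃ jk : ℕ → ℕ, StrictMono jk ∧ ∃ g : ℕ → ℂ → ℂ,
    (∀ k, DifferentiableOn ℂ (g k) (ball 0 1) ∧ MapsTo (g k) (ball 0 1) (ball 0 1)) ∧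
    WeakConv (fun k => bmeas ((L.f (jk k)) ∘ (g k))) μ ∧
    Tendsto (fun k => L.f (jk k) (g k 0)) atTop (𝓝 z)}

/-- `J_z(L)`: the convex hull of `J_z^s(L)`. -/
def JLSet {n : ℕ} (L : PerfectSeq n) (z : En n) : Set (Measure (En n)) :=
  {μ | ∃ (m : ℕ) (w : Fin m → ℝ) (ν : Fin m → Measure (En n)),
    (∀ i, 0 ≤ w i) ∧ (∑ i, w i = 1) ∧ (∀ i, ν i ∈ JsSet L z) ∧
    μ = ∑ i, (ENNReal.ofReal (w i)) • ν i}

/-- `u` is harmonic on the totally perfect sequence `L`. -/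
def HarmonicOnL {n : ℕ} (L : PerfectSeq n) (u : En n → EReal) : Prop :=
  PSHce (clusterSet L.f) u ∧
  ∀ z ∈ clusterSet L.f, ∀ μ ∈ JLSet L z, eint μ u = u z

/-- `PSH^w(X)`: weakly plurisubharmonic functions, the upper envelopes of nonempty families
of continuous plurisubharmonic functions on `X`. -/
def PSHw {n : ℕ} (X : Set (En n)) (u : En n → EReal) : Prop :=
  ∃ F : Set (En n → EReal), F.Nonempty ∧ (∀ v ∈ F, PSHce X v) ∧
    ∀ x ∈ X, u x = ⨆ v ∈ F, v x

/-- `u` is maximal on `X ∖ Z`: for every relatively open `V ⊆ X ∖ Z` and every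
`v ∈ PSH^c(closure V)`, if `v ≤ u` on the relative boundary of `V` in `X` then `v ≤ u`
on `closure V`. -/
def MaximalOn {n : ℕ} (X Z : Set (En n)) (u : En n → EReal) : Prop :=
  ∀ W : Set (En n), IsOpen W → X ∩ W ⊆ X \ Z →
    ∀ v : En n → EReal, PSHce (closure (X ∩ W)) v →
      (∀ x ∈ closure (X ∩ W) \ (X ∩ W), v x ≤ u x) →
      ∀ x ∈ closure (X ∩ W), v x ≤ u x

/-- Pluriharmonic continuous real-valued functions on `X`. -/
def Pluriharm {n : ℕ} (X : Set (En n)) (h : En n → ℝ) : Prop :=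
  ContinuousOn h X ∧
  ∀ z ∈ X, ∀ μ : Measure (En n), IsJensen X z μ → (h z : EReal) = eint μ (fun x => (h x : EReal))

/-- `X` is a Poisson set: every continuous real-valued function on `B_X` extends to a
pluriharmonic function on `X`. -/
def PoissonSet {n : ℕ} (X : Set (En n)) : Prop :=
  ∀ φ : En n → ℝ, ContinuousOn φ (Bset X) →
    ∃ h : En n → ℝ, Pluriharm X h ∧ ∀ w ∈ Bset X, h w = φ w

end

theorem nonneg_on_closedBall_of_isLocalMin_eventuallyEq {u : ℂ → ℝ} {c : ℂ} {R : ℝ} (hR : 0 < R)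
    (hu : ContinuousOn u (closedBall c R)) (hb : ∀ z ∈ sphere c R, 0 ≤ u z)
    (hloc : ∀ z ∈ ball c R, IsLocalMin u z → ∀ᶠ w in 𝓝 z, u w = u z) :
    ∀ z ∈ closedBall c R, 0 ≤ u z := by
  obtain ⟨z₀, hz₀, hmin⟩ := (isCompact_closedBall c R).exists_isMinOn
    ⟨c, mem_closedBall_self hR.le⟩ hu
  suffices h : 0 ≤ u z₀ from fun z hz => h.trans (hmin hz)
  by_contra! hneg
  have hz₀b : z₀ ∈ ball c R := by
    rcases (mem_closedBall.1 hz₀).lt_or_eq with h | h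
    · exact h
    · exact absurd (hb z₀ h) (not_le.2 hneg)
  have hsub : EqOn u (fun _ => u z₀) (ball c R) := by
    intro z hz
    refine ((isPreconnected_ball : IsPreconnected (ball c R)).induction₂
      (fun x y => u x = u z₀ ↔ u y = u z₀) ?_ ?_ ?_ hz₀b hz).1 rfl
    · intro x hx
      by_cases h : u x = u z₀
      · have hlm : IsLocalMin u x := by
          filter_upwards [isOpen_ball.mem_nhds hx] with y hy
          rw [h]; exact hmin (ball_subset_closedBall hy)
        filter_upwards [nhdsWithin_le_nhds (hloc x hx hlm)] with y hy
        rw [hy]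
      · have := ((hu x (ball_subset_closedBall hx)).mono ball_subset_closedBall).eventually_ne h
        filter_upwards [this] with y hy
        simp [h, hy]
    · intro x y z _ _ _ h1 h2
      exact h1.trans h2
    · intro x y _ _ h
      exact h.symm
  have hcl : EqOn u (fun _ => u z₀) (closedBall c R) :=
    hsub.of_subset_closure hu continuousOn_const ball_subset_closedBall
      (closure_ball c hR.ne').ge
  have hs : c + R ∈ sphere c R := by simp [abs_of_pos hR]
  have := hcl (sphere_subset_closedBall hs)
  linarith [hb _ hs]

theorem eventually_eq_of_isLocalMin_of_circleAverage_le {u : ℂ → ℝ} {z : ℂ}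
    (hc : ∀ᶠ w in 𝓝 z, ContinuousAt u w)
    (hm : ∀ᶠ r in 𝓝[>] (0 : ℝ), Real.circleAverage u z r ≤ u z) (hmin : IsLocalMin u z) :
    ∀ᶠ w in 𝓝 z, u w = u z := by
  obtain ⟨ρ, hρ, h⟩ := Metric.eventually_nhds_iff_ball.1 (hc.and hmin)
  obtain ⟨ρ', hρ', hm'⟩ := mem_nhdsGT_iff_exists_Ioo_subset.1 hm
  rw [Metric.eventually_nhds_iff_ball]
  refine ⟨min ρ ρ', lt_min hρ hρ', fun w hw => ?_⟩
  by_contra hne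
  have hwz : w ≠ z := fun h => hne (by rw [h])
  have hr0 : 0 < dist w z := dist_pos.2 hwz
  have hrρ : dist w z < ρ := (mem_ball.1 hw).trans_le (min_le_left _ _)
  have hav := hm' ⟨hr0, (mem_ball.1 hw).trans_le (min_le_right _ _)⟩
  set r := dist w z with hr
  have hcm : ∀ θ, circleMap z r θ ∈ ball z ρ := fun θ => by
    rw [mem_ball, dist_comm, dist_eq_norm, ← norm_neg]
    simpa [abs_of_pos hr0, circleMap] using hrρ
  have hwim : w ∈ circleMap z r '' Ioc 0 (2 * Real.pi) := by
    rw [image_circleMap_Ioc, abs_of_pos hr0]; exact mem_sphere.2 rfl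
  obtain ⟨θ₀, hθ₀, hθw⟩ := hwim
  have hcont : Continuous fun θ => u (circleMap z r θ) := by
    rw [continuous_iff_continuousAt]
    intro θ
    exact ContinuousAt.comp (f := circleMap z r) (h _ (hcm θ)).1
      (continuous_circleMap z r).continuousAt
  have hlt : ∫ θ in (0 : ℝ)..2 * Real.pi, u z < ∫ θ in (0 : ℝ)..2 * Real.pi, u (circleMap z r θ) := by
    refine intervalIntegral.integral_lt_integral_of_continuousOn_of_le_of_exists_lt
      Real.two_pi_pos continuousOn_const hcont.continuousOn (fun θ _ => (h _ (hcm θ)).2)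
      ⟨θ₀, Ioc_subset_Icc_self hθ₀, ?_⟩
    refine lt_of_le_of_ne (h _ (hcm θ₀)).2 ?_
    rw [hθw]; exact Ne.symm hne
  have hav' : (2 * Real.pi)⁻¹ * ∫ θ in (0 : ℝ)..2 * Real.pi, u (circleMap z r θ) ≤ u z := hav
  rw [inv_mul_le_iff₀ Real.two_pi_pos] at hav'
  simp at hlt
  linarith

theorem exists_entire_re_near {φ : ℂ → ℝ} {c : ℂ} {R : ℝ} (hR : 0 < R)
    (hφ : ContinuousOn φ (sphere c R)) {ε : ℝ} (hε : 0 < ε) :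
    ∃ P : ℂ → ℂ, Differentiable ℂ P ∧ ∀ z ∈ sphere c R, |(P z).re - φ z| < ε := by
  have : Fact ((0 : ℝ) < 1) := ⟨one_pos⟩
  let e : AddCircle (1 : ℝ) → ℂ := fun x => c + R * (AddCircle.toCircle x : ℂ)
  have he : Continuous e := by
    have : Continuous fun x : AddCircle (1 : ℝ) => (AddCircle.toCircle x : ℂ) :=
      continuous_subtype_val.comp AddCircle.continuous_toCircle
    fun_prop
  have hes : ∀ x, e x ∈ sphere c R := fun x => by simp [e, abs_of_pos hR, Circle.norm_coe]
  let Φ : C(AddCircle (1 : ℝ), ℂ) :=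
    ⟨fun x => (φ (e x) : ℂ), by
      exact Complex.continuous_ofReal.comp (hφ.comp_continuous he hes)⟩
  have hΦ : Φ ∈ (Submodule.span ℂ (range <| @fourier (1 : ℝ))).topologicalClosure := by
    rw [span_fourier_closure_eq_top]; trivial
  obtain ⟨g, hg, hgd⟩ := Metric.mem_closure_iff.1 hΦ ε hε
  have key : ∀ a : ℂ, ∃ P : ℂ → ℂ, Differentiable ℂ P ∧ ∀ x, (a * g x).re = (P (e x)).re := by
    refine Submodule.span_induction (p := fun g _ => ∀ a : ℂ, ∃ P : ℂ → ℂ, Differentiable ℂ P ∧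
      ∀ x, (a * g x).re = (P (e x)).re) ?_ ?_ ?_ ?_ hg
    · rintro _ ⟨n, rfl⟩ a
      have hx : ∀ x, ((e x - c) / R) = (AddCircle.toCircle x : ℂ) := fun x => by
        have : (R : ℂ) ≠ 0 := by exact_mod_cast hR.ne'
        simp only [e]; field_simp; ring
      rcases Int.eq_nat_or_neg n with ⟨k, rfl | rfl⟩
      · refine ⟨fun z => a * ((z - c) / R) ^ k, by fun_prop, fun x => ?_⟩
        simp only [hx, fourier_apply]
        simp [AddCircle.toCircle_nsmul]
      · refine ⟨fun z => (starRingEnd ℂ a) * ((z - c) / R) ^ k, by fun_prop, fun x => ?_⟩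
        have h : (fourier (-(k : ℤ)) x : ℂ) = starRingEnd ℂ ((AddCircle.toCircle x : ℂ) ^ k) := by
          rw [fourier_neg, fourier_apply]
          simp [AddCircle.toCircle_nsmul]
        rw [h]
        simp only [hx]
        rw [← Complex.conj_re, map_mul, Complex.conj_conj]
    · exact fun a => ⟨fun _ => 0, by fun_prop, by simp⟩
    · intro x y _ _ hx hy a
      obtain ⟨P, hP, hP'⟩ := hx a
      obtain ⟨Q, hQ, hQ'⟩ := hy a
      refine ⟨fun z => P z + Q z, by fun_prop, fun t => ?_⟩
      rw [Complex.add_re, ← hP', ← hQ', ContinuousMap.add_apply, mul_add, Complex.add_re]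
    · intro b x _ hx a
      obtain ⟨P, hP, hP'⟩ := hx (a * b)
      refine ⟨P, hP, fun t => ?_⟩
      rw [← hP', ContinuousMap.smul_apply, smul_eq_mul, mul_assoc]
  obtain ⟨P, hP, hP'⟩ := key 1
  refine ⟨P, hP, fun z hz => ?_⟩
  obtain ⟨x, rfl⟩ : ∃ x, e x = z := by
    have hmem : ‖(z - c) / R‖ = 1 := by
      rw [norm_div, mem_sphere_iff_norm.1 hz]; simp [abs_of_pos hR, hR.ne']
    obtain ⟨x, hx⟩ := (AddCircle.homeomorphCircle (one_ne_zero : (1 : ℝ) ≠ 0)).surjective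
      ⟨(z - c) / R, mem_sphere_zero_iff_norm.2 hmem⟩
    refine ⟨x, ?_⟩
    have : (AddCircle.toCircle x : ℂ) = (z - c) / R := by
      have := congrArg (Subtype.val) hx
      simpa [AddCircle.homeomorphCircle_apply] using this
    have hR' : (R : ℂ) ≠ 0 := by exact_mod_cast hR.ne'
    simp only [e, this]; field_simp; ring
  have h1 := (ContinuousMap.dist_apply_le_dist x).trans_lt hgd
  rw [← hP', one_mul]
  have h2 : |(g x - Φ x).re| ≤ ‖g x - Φ x‖ := Complex.abs_re_le_norm _
  rw [dist_comm, dist_eq_norm] at h1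
  simpa [Φ] using h2.trans_lt h1

theorem circleAverage_re_entire {P : ℂ → ℂ} (hP : Differentiable ℂ P) (c : ℂ) (r : ℝ) :
    Real.circleAverage (fun z => (P z).re) c r = (P c).re := by
  have h := (hP.diffContOnCl (s := ball c |r|)).circleAverage
  have h2 := Complex.reCLM.circleAverage_comp_comm (f := P) (c := c) (R := r)
    hP.continuous.continuousOn.circleIntegrable'
  rw [h] at h2
  exact h2

theorem circleAverage_re_of_differentiableOn {P : ℂ → ℂ} {c : ℂ} {r ρ : ℝ}
    (hP : DifferentiableOn ℂ P (ball c ρ)) (hr : 0 < r) (hrρ : r < ρ) :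
    Real.circleAverage (fun z => (P z).re) c r = (P c).re := by
  have hsub : closedBall c |r| ⊆ ball c ρ := by
    rw [abs_of_pos hr]; exact closedBall_subset_ball hrρ
  have h := (hP.mono hsub).diffContOnCl_ball subset_rfl |>.circleAverage
  have h2 := Complex.reCLM.circleAverage_comp_comm (f := P) (c := c) (R := r)
    (hP.continuousOn.mono (sphere_subset_closedBall.trans hsub)).circleIntegrable'
  rw [h] at h2
  exact h2

theorem re_entire_le_of_isLocalMin {W : ℂ → ℝ} {c : ℂ} {R : ℝ} (hR : 0 < R)
    (hW : ContinuousOn W (closedBall c R)) {P : ℂ → ℂ} (hP : Differentiable ℂ P)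
    (hloc : ∀ z ∈ ball c R, IsLocalMin (fun w => W w - (P w).re) z →
      ∀ᶠ w in 𝓝 z, W w - (P w).re = W z - (P z).re)
    (hle : ∀ z ∈ sphere c R, (P z).re ≤ W z) : ∀ z ∈ closedBall c R, (P z).re ≤ W z := by
  intro z hz
  have hPc := hP.continuous
  have := nonneg_on_closedBall_of_isLocalMin_eventuallyEq (u := fun w => W w - (P w).re) hR
    (hW.sub (by fun_prop)) (fun z hz => sub_nonneg.2 (hle z hz)) hloc z hz
  linarith

theorem circleAverage_le_of_isLocalMin {W : ℂ → ℝ} {c : ℂ} {R : ℝ} (hR : 0 < R)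
    (hW : ContinuousOn W (closedBall c R))
    (hloc : ∀ P : ℂ → ℂ, Differentiable ℂ P → ∀ z ∈ ball c R,
      IsLocalMin (fun w => W w - (P w).re) z →
      ∀ᶠ w in 𝓝 z, W w - (P w).re = W z - (P z).re) :
    Real.circleAverage W c R ≤ W c := by
  refine le_of_forall_pos_le_add fun ε hε => ?_
  obtain ⟨P, hP, hPn⟩ := exists_entire_re_near (φ := fun z => W z - ε / 2) hR
    ((hW.mono sphere_subset_closedBall).sub continuousOn_const) (half_pos hε)
  have hPc := hP.continuous
  have h1 := re_entire_le_of_isLocalMin hR hW hP (hloc P hP)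
    (fun z hz => by have := (abs_lt.1 (hPn z hz)).2; linarith) c (mem_closedBall_self hR.le)
  have hWi : CircleIntegrable W c R :=
    (hW.mono sphere_subset_closedBall).circleIntegrable hR.le
  have h2 : Real.circleAverage W c R ≤ Real.circleAverage (fun z => (P z + ε).re) c R := by
    refine Real.circleAverage_mono hWi ?_ ?_
    · exact (Continuous.continuousOn (by fun_prop)).circleIntegrable hR.le
    · intro z hz
      rw [abs_of_pos hR] at hz
      have := (abs_lt.1 (hPn z hz)).1
      simp; linarith
  rw [circleAverage_re_entire (by fun_prop)] at h2
  simp at h2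
  linarith

theorem ContinuousOn.circleIntegrable_of_closedBall_subset {E : Type*} [NormedAddCommGroup E]
    {u : ℂ → E} {Ω : Set ℂ} (hu : ContinuousOn u Ω) {z : ℂ} {r : ℝ} (hr : 0 ≤ r)
    (h : closedBall z r ⊆ Ω) : CircleIntegrable u z r :=
  (hu.mono (sphere_subset_closedBall.trans h)).circleIntegrable hr

theorem eventually_closedBall_subset_of_isOpen {Ω : Set ℂ} (hΩ : IsOpen Ω) {z : ℂ} (hz : z ∈ Ω) :
    ∀ᶠ r in 𝓝[>] (0 : ℝ), 0 < r ∧ closedBall z r ⊆ Ω := by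
  obtain ⟨ρ, hρ, h⟩ := Metric.isOpen_iff.1 hΩ z hz
  filter_upwards [Ioo_mem_nhdsGT hρ] with r hr
  exact ⟨hr.1, (closedBall_subset_ball hr.2).trans h⟩

theorem SuperharmOn.circleAverage_le {v : ℂ → ℝ} {Ω : Set ℂ} (hv : SuperharmOn v Ω) {z : ℂ} {r : ℝ}
    (hr : 0 < r) (h : closedBall z r ⊆ Ω) : Real.circleAverage v z r ≤ v z :=
  hv.2 z (h (mem_closedBall_self hr.le)) r hr h

theorem superharmOn_of_eventually_circleAverage_le {W : ℂ → ℝ} {Ω : Set ℂ} (hΩ : IsOpen Ω)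
    (hW : ContinuousOn W Ω)
    (hm : ∀ z ∈ Ω, ∀ᶠ r in 𝓝[>] (0 : ℝ), Real.circleAverage W z r ≤ W z) : SuperharmOn W Ω := by
  refine ⟨fun z hz => (hW z hz).lowerSemicontinuousWithinAt, fun c _ R hR hc => ?_⟩
  refine circleAverage_le_of_isLocalMin hR (hW.mono hc) fun P hP z hz hmin => ?_
  have hzΩ := hc (ball_subset_closedBall hz)
  refine eventually_eq_of_isLocalMin_of_circleAverage_le (u := fun w => W w - (P w).re) ?_ ?_ hmin
  · filter_upwards [hΩ.mem_nhds hzΩ] with w hw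
    have := hP.continuous
    exact (hW.continuousAt (hΩ.mem_nhds hw)).sub (by fun_prop)
  · filter_upwards [hm z hzΩ, eventually_closedBall_subset_of_isOpen hΩ hzΩ] with r hr hr'
    have hPc := hP.continuous
    rw [Real.circleAverage_fun_sub (hW.circleIntegrable_of_closedBall_subset hr'.1.le hr'.2)
      (ContinuousOn.circleIntegrable hr'.1.le (Continuous.continuousOn (by fun_prop))),
      circleAverage_re_entire hP]
    linarith

theorem circleAverage_comp_le {v : ℂ → ℝ} {a : ℂ → ℂ} {c : ℂ} {R : ℝ} (hR : 0 < R)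
    (hv : SuperharmOn v (ball 0 1)) (hvc : ContinuousOn v (ball 0 1))
    (ha : ContinuousOn a (closedBall c R)) (hmaps : MapsTo a (closedBall c R) (ball 0 1))
    (hinv : ∀ z ∈ ball c R, ∃ b : ℂ → ℂ, (∀ᶠ y in 𝓝 (a z), DifferentiableAt ℂ b y) ∧
      (∀ᶠ y in 𝓝 (a z), a (b y) = y) ∧ (∀ᶠ z' in 𝓝 z, b (a z') = z')) :
    Real.circleAverage (fun z => v (a z)) c R ≤ v (a c) := by
  refine circleAverage_le_of_isLocalMin (W := fun z => v (a z)) hR (hvc.comp ha hmaps)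
    fun P hP z hz hmin => ?_
  obtain ⟨b, hb, hab, hba⟩ := hinv z hz
  have hz1 : a z ∈ ball (0 : ℂ) 1 := hmaps (ball_subset_closedBall hz)
  have hbz : b (a z) = z := hba.self_of_nhds
  have haz : Tendsto a (𝓝 z) (𝓝 (a z)) :=
    (ha.mono ball_subset_closedBall).continuousAt (isOpen_ball.mem_nhds hz)
  have hbc : Tendsto b (𝓝 (a z)) (𝓝 z) := by
    have := hb.self_of_nhds.continuousAt.tendsto
    rwa [hbz] at this
  have hloc : ∀ᶠ y in 𝓝 (a z), v y - (P (b y)).re = v (a z) - (P (b (a z))).re := by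
    refine eventually_eq_of_isLocalMin_of_circleAverage_le (u := fun y => v y - (P (b y)).re)
      ?_ ?_ ?_
    · filter_upwards [hb, isOpen_ball.mem_nhds hz1] with y hy hy1
      have hPb : ContinuousAt (fun y => P (b y)) y :=
        ContinuousAt.comp (f := b) hP.continuous.continuousAt hy.continuousAt
      exact (hvc.continuousAt (isOpen_ball.mem_nhds hy1)).sub
        (Complex.continuous_re.continuousAt.comp hPb)
    · obtain ⟨ρ, hρ, hbρ⟩ := Metric.eventually_nhds_iff_ball.1 hb
      have hd : DifferentiableOn ℂ (fun y => P (b y)) (ball (a z) ρ) := fun y hy =>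
        (hP.differentiableAt.comp y (hbρ y hy)).differentiableWithinAt
      filter_upwards [eventually_closedBall_subset_of_isOpen isOpen_ball hz1, Ioo_mem_nhdsGT hρ]
        with r hr hrρ
      have hci : CircleIntegrable (fun y => (P (b y)).re) (a z) r :=
        (Complex.continuous_re.comp_continuousOn hd.continuousOn).circleIntegrable_of_closedBall_subset
          hr.1.le (closedBall_subset_ball hrρ.2)
      rw [Real.circleAverage_fun_sub (hvc.circleIntegrable_of_closedBall_subset hr.1.le hr.2) hci,
        circleAverage_re_of_differentiableOn hd hr.1 hrρ.2]
      have := hv.circleAverage_le hr.1 hr.2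
      linarith
    · filter_upwards [hbc.eventually hmin, hab] with y hy hy'
      rw [hy'] at hy
      simpa only [hbz] using hy
  filter_upwards [haz.eventually hloc, hba] with z' h1 h2
  rwa [h2, hbz] at h1

theorem norm_le_re_entire_of_sphere {E : Type*} [NormedAddCommGroup E] [NormedSpace ℂ E]
    [CompleteSpace E] {h : ℂ → E} {c : ℂ} {R : ℝ} (hR : 0 < R)
    (hh : DiffContOnCl ℂ h (ball c R)) {P : ℂ → ℂ} (hP : Differentiable ℂ P)
    (hle : ∀ z ∈ sphere c R, ‖h z‖ ≤ (P z).re) : ∀ z ∈ closedBall c R, ‖h z‖ ≤ (P z).re := by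
  have hPc := hP.continuous
  intro z hz
  refine sub_nonneg.1 (nonneg_on_closedBall_of_isLocalMin_eventuallyEq
    (u := fun z => (P z).re - ‖h z‖) hR ?_ (fun z hz => sub_nonneg.2 (hle z hz)) ?_ z hz)
  · exact ContinuousOn.sub (by fun_prop) hh.continuousOn_ball.norm
  · intro z hz hmin
    refine eventually_eq_of_isLocalMin_of_circleAverage_le (u := fun z => (P z).re - ‖h z‖)
      ?_ ?_ hmin
    · filter_upwards [isOpen_ball.mem_nhds hz] with w hw
      exact ContinuousAt.sub (by fun_prop)
        ((hh.differentiableOn.differentiableAt (isOpen_ball.mem_nhds hw)).continuousAt.norm)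
    · filter_upwards [eventually_closedBall_subset_of_isOpen isOpen_ball hz] with r hr
      have hhc := hh.differentiableOn.continuousOn
      rw [Real.circleAverage_fun_sub
        (ContinuousOn.circleIntegrable hr.1.le (Continuous.continuousOn (by fun_prop)))
        (hhc.norm.circleIntegrable_of_closedBall_subset hr.1.le hr.2), circleAverage_re_entire hP]
      have h1 : Real.circleAverage h z r = h z := by
        refine DiffContOnCl.circleAverage ?_
        rw [abs_of_pos hr.1]
        exact hh.differentiableOn.diffContOnCl_ball hr.2
      have h2 : ‖Real.circleAverage h z r‖ ≤ Real.circleAverage (fun z => ‖h z‖) z r := by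
        rw [Real.circleAverage, Real.circleAverage, norm_smul, smul_eq_mul, Real.norm_of_nonneg
          (by positivity)]
        gcongr
        exact intervalIntegral.norm_integral_le_integral_norm Real.two_pi_pos.le
      rw [h1] at h2
      linarith

theorem norm_sub_le_of_re_pos {g : ℂ → ℂ} {w z : ℂ} {R : ℝ}
    (hg : DifferentiableOn ℂ g (ball w R)) (hpos : ∀ z ∈ ball w R, 0 < (g z).re)
    (hz : z ∈ ball w R) : ‖g z - g w‖ ≤ 2 * (g w).re * ‖z - w‖ / (R - ‖z - w‖) := by
  have hR : 0 < R := pos_of_mem_ball hz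
  have hsub : ∀ x ∈ ball (0 : ℂ) R, w + x ∈ ball w R := fun x hx => by simpa using hx
  have h := borelCaratheodory_zero (f := fun x => g w - g (w + x)) (M := (g w).re) (R := R)
    (z := z - w) (hpos w (mem_ball_self hR)) ?_ ?_ hR ?_ (by simp)
  · rw [← norm_neg]; simpa using h
  · refine (differentiableOn_const _).sub (hg.comp (by fun_prop) hsub)
  · intro x hx
    have := hpos _ (hsub x hx)
    simp only [mem_ofPred_eq, Complex.sub_re]; linarith
  · rwa [mem_ball_zero_iff, ← dist_eq_norm]

theorem norm_deriv_le_of_re_pos {g : ℂ → ℂ} {w : ℂ} {R : ℝ} (hR : 0 < R)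
    (hg : DifferentiableOn ℂ g (ball w R)) (hpos : ∀ z ∈ ball w R, 0 < (g z).re) :
    ‖deriv g w‖ ≤ 2 * (g w).re / R := by
  have hd : HasDerivAt g (deriv g w) w :=
    (hg.differentiableAt (ball_mem_nhds w hR)).hasDerivAt
  have ht := (hasDerivAt_iff_tendsto_slope.1 hd).norm
  have ht2 : Tendsto (fun z => 2 * (g w).re / (R - ‖z - w‖)) (𝓝[≠] w) (𝓝 (2 * (g w).re / R)) := by
    have : ContinuousAt (fun z => 2 * (g w).re / (R - ‖z - w‖)) w := by
      refine ContinuousAt.div (by fun_prop) (by fun_prop) (by simpa using hR.ne')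
    have := this.tendsto.mono_left (nhdsWithin_le_nhds (s := {w}ᶜ))
    simpa using this
  refine le_of_tendsto_of_tendsto ht ht2 ?_
  filter_upwards [self_mem_nhdsWithin, nhdsWithin_le_nhds (ball_mem_nhds w hR)] with z hne hz
  have h := norm_sub_le_of_re_pos hg hpos hz
  have hzw : 0 < ‖z - w‖ := norm_pos_iff.2 (sub_ne_zero.2 hne)
  rw [slope_def_field, norm_div, div_le_iff₀ hzw]
  exact h.trans_eq (by ring)

/-- The competitors in the definition of the harmonic measure of `A`. -/
structure IsBarrier (A : Set ℂ) (v : ℂ → ℝ) : Prop where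
  superharm : SuperharmOn v (ball 0 1)
  pos : ∀ w ∈ ball (0 : ℂ) 1, 0 < v w
  cont : ContinuousOn v (closedBall 0 1)
  one_le : ∀ w ∈ A, 1 ≤ v w

theorem isBarrier_one (A : Set ℂ) : IsBarrier A fun _ => 1 where
  superharm := superharmOn_of_eventually_circleAverage_le isOpen_ball continuousOn_const
    fun z _ => Eventually.of_forall fun r => (Real.circleAverage_const 1 z r).le
  pos := fun _ _ => one_pos
  cont := continuousOn_const
  one_le := fun _ _ => le_rfl

theorem IsBarrier.mono {A B : Set ℂ} {v : ℂ → ℝ} (h : IsBarrier B v) (hAB : A ⊆ B) :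
    IsBarrier A v := ⟨h.superharm, h.pos, h.cont, fun w hw => h.one_le w (hAB hw)⟩

theorem IsBarrier.nonneg {A : Set ℂ} {v : ℂ → ℝ} (h : IsBarrier A v) :
    ∀ w ∈ closedBall (0 : ℂ) 1, 0 ≤ v w := by
  intro w hw
  rw [← closure_ball (0 : ℂ) one_ne_zero] at hw
  have hc := h.cont
  rw [← closure_ball (0 : ℂ) one_ne_zero] at hc
  exact le_on_closure (f := fun _ => (0 : ℝ)) (fun x hx => (h.pos x hx).le) continuousOn_const hc hw

theorem hmPre_le {A : Set ℂ} {v : ℂ → ℝ} {z : ℂ} (h : IsBarrier A v) (hz : z ∈ ball (0 : ℂ) 1) :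
    hmPre A z ≤ v z := by
  refine csInf_le ⟨0, ?_⟩ ⟨v, h.superharm, h.pos, h.cont, h.one_le, rfl⟩
  rintro t ⟨u, _, hu, _, _, rfl⟩
  exact (hu z hz).le

theorem le_hmPre {A : Set ℂ} {z : ℂ} {c : ℝ} (h : ∀ v, IsBarrier A v → c ≤ v z) :
    c ≤ hmPre A z := by
  have h1 := isBarrier_one A
  refine le_csInf ⟨_, _, h1.superharm, h1.pos, h1.cont, h1.one_le, rfl⟩ ?_
  rintro t ⟨u, h1, h2, h3, h4, rfl⟩
  exact h u ⟨h1, h2, h3, h4⟩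

theorem exists_isBarrier_lt {A : Set ℂ} {z : ℂ} {c : ℝ} (h : hmPre A z < c) :
    ∃ v, IsBarrier A v ∧ v z < c := by
  by_contra! hc
  exact h.not_ge (le_hmPre hc)

theorem hmPre_nonneg {A : Set ℂ} {z : ℂ} (hz : z ∈ ball (0 : ℂ) 1) : 0 ≤ hmPre A z :=
  le_hmPre fun _ hv => (hv.pos z hz).le

theorem hmPre_le_one {A : Set ℂ} {z : ℂ} (hz : z ∈ ball (0 : ℂ) 1) : hmPre A z ≤ 1 :=
  hmPre_le (isBarrier_one A) hz

theorem hmPre_mono {A B : Set ℂ} {z : ℂ} (hz : z ∈ ball (0 : ℂ) 1) (hAB : A ⊆ B) :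
    hmPre A z ≤ hmPre B z :=
  le_hmPre fun _ hv => hmPre_le (hv.mono hAB) hz

theorem eventually_mem_unitBall : ∀ᶠ z in 𝓝 (0 : ℂ), z ∈ ball (0 : ℂ) 1 := ball_mem_nhds 0 one_pos

theorem isBoundedUnder_ge_hmPre (A : Set ℂ) : IsBoundedUnder (· ≥ ·) (𝓝 0) (hmPre A) :=
  ⟨0, eventually_map.2 (eventually_mem_unitBall.mono fun _ hz => hmPre_nonneg hz)⟩

theorem isBoundedUnder_le_hmPre (A : Set ℂ) : IsBoundedUnder (· ≤ ·) (𝓝 0) (hmPre A) :=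
  ⟨1, eventually_map.2 (eventually_mem_unitBall.mono fun _ hz => hmPre_le_one hz)⟩

theorem hm_le_of_frequently {A : Set ℂ} {c : ℝ} (h : ∃ᶠ z in 𝓝 (0 : ℂ), hmPre A z ≤ c) :
    hm 0 A ≤ c :=
  liminf_le_of_frequently_le h (isBoundedUnder_ge_hmPre A)

theorem frequently_hmPre_lt {A : Set ℂ} {c : ℝ} (h : hm 0 A < c) :
    ∃ᶠ z in 𝓝 (0 : ℂ), hmPre A z < c :=
  frequently_lt_of_liminf_lt (isBoundedUnder_le_hmPre A).isCoboundedUnder_ge h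

theorem hm_nonneg (A : Set ℂ) : 0 ≤ hm 0 A :=
  le_liminf_of_le (isBoundedUnder_le_hmPre A).isCoboundedUnder_ge
    (eventually_mem_unitBall.mono fun _ hz => hmPre_nonneg hz)

theorem hm_le_one (A : Set ℂ) : hm 0 A ≤ 1 :=
  hm_le_of_frequently (eventually_mem_unitBall.mono fun _ hz => hmPre_le_one hz).frequently

theorem hm_mono {A B : Set ℂ} (hAB : A ⊆ B) : hm 0 A ≤ hm 0 B :=
  le_of_forall_gt_imp_ge_of_dense fun _ hc => hm_le_of_frequently
    (((frequently_hmPre_lt hc).and_eventually eventually_mem_unitBall).mono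
      fun _ hz => (hmPre_mono hz.2 hAB).trans hz.1.le)

theorem hm_le_add_of_comp {A B : Set ℂ} {p : ℂ → ℂ} {c : ℝ} (hp : Tendsto p (𝓝 0) (𝓝 0))
    (h : ∀ᶠ z in 𝓝 (0 : ℂ), hmPre A (p z) ≤ hmPre B z + c) : hm 0 A ≤ hm 0 B + c := by
  rw [← sub_le_iff_le_add]
  refine le_of_forall_gt_imp_ge_of_dense fun a ha => sub_le_iff_le_add.2 ?_
  refine hm_le_of_frequently (hp.frequently ?_)
  exact ((frequently_hmPre_lt ha).and_eventually h).mono fun z hz => by linarith [hz.1, hz.2]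

theorem circleAverage_min_le {u v : ℂ → ℝ} {z : ℂ} {r : ℝ} (hu : CircleIntegrable u z r)
    (hv : CircleIntegrable v z r) (hmin : CircleIntegrable (fun w => min (u w) (v w)) z r) :
    Real.circleAverage (fun w => min (u w) (v w)) z r ≤
      min (Real.circleAverage u z r) (Real.circleAverage v z r) :=
  le_min (Real.circleAverage_mono hmin hu fun _ _ => min_le_left _ _)
    (Real.circleAverage_mono hmin hv fun _ _ => min_le_right _ _)

theorem le_re_entire_of_sphere {P : ℂ → ℂ} (hP : Differentiable ℂ P) {c : ℂ} {R m : ℝ}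
    (hR : 0 < R) (h : ∀ z ∈ sphere c R, m ≤ (P z).re) : ∀ z ∈ closedBall c R, m ≤ (P z).re := by
  have hPc := hP.continuous
  refine re_entire_le_of_isLocalMin (W := fun z => (P z).re) (P := fun _ => (m : ℂ)) hR
    (by fun_prop) (by fun_prop) ?_ (by simpa using h)
  intro z _ hmin
  refine eventually_eq_of_isLocalMin_of_circleAverage_le
    (u := fun z => (P z).re - ((m : ℂ)).re) (Eventually.of_forall fun w => by fun_prop)
    (Eventually.of_forall fun r => ?_) hmin
  have := circleAverage_re_entire (P := fun z => P z - m) (by fun_prop) z r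
  simpa using this.le

theorem IsBarrier.exists_harnack {A : Set ℂ} {v : ℂ → ℝ} (hv : IsBarrier A v) {d ε : ℝ}
    (hd : 0 < d) (hd1 : d < 1) (hA : Disjoint A (ball 0 d)) {w : ℂ} (hw : w ∈ ball (0 : ℂ) (d / 4))
    (hwε : v w < ε) : ∃ v', IsBarrier A v' ∧ ∀ z ∈ ball (0 : ℂ) (d / 4), v' z ≤ 5 * ε := by
  have hsub : closedBall (0 : ℂ) d ⊆ ball 0 1 := closedBall_subset_ball hd1
  have hvb : ContinuousOn v (ball 0 1) := hv.cont.mono ball_subset_closedBall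
  obtain ⟨κ, hκ, hκε⟩ : ∃ κ, 0 < κ ∧ v w + κ < ε := ⟨(ε - v w) / 2, by linarith, by linarith⟩
  obtain ⟨P, hP, hPs⟩ := exists_entire_re_near (φ := fun z => v z + κ / 2) hd
    ((hvb.mono (sphere_subset_closedBall.trans hsub)).add continuousOn_const)
    (show 0 < κ / 4 by linarith)
  have hPc := hP.continuous
  have hlow : ∀ z ∈ sphere (0 : ℂ) d, v z < (P z).re := fun z hz => by
    have := abs_lt.1 (hPs z hz); linarith
  have hup : ∀ z ∈ closedBall (0 : ℂ) d, (P z).re ≤ v z + κ := by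
    have := re_entire_le_of_isLocalMin (W := v) (P := fun z => P z - κ) hd (hvb.mono hsub)
      (by fun_prop) ?_ ?_
    · intro z hz
      have := this z hz
      simp at this
      linarith
    · intro z hz hmin
      have hz1 := hsub (ball_subset_closedBall hz)
      refine eventually_eq_of_isLocalMin_of_circleAverage_le
        (u := fun z => v z - (P z - κ).re) ?_ ?_ hmin
      · filter_upwards [isOpen_ball.mem_nhds hz1] with y hy
        exact (hvb.continuousAt (isOpen_ball.mem_nhds hy)).sub (by fun_prop)
      · filter_upwards [eventually_closedBall_subset_of_isOpen isOpen_ball hz1] with r hr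
        rw [Real.circleAverage_fun_sub (hvb.circleIntegrable_of_closedBall_subset hr.1.le hr.2)
          (ContinuousOn.circleIntegrable hr.1.le (by fun_prop)),
          circleAverage_re_entire (P := fun z => P z - κ) (by fun_prop)]
        exact sub_le_sub_right (hv.superharm.circleAverage_le hr.1 hr.2) _
    · intro z hz
      have := abs_lt.1 (hPs z hz)
      simp
      linarith
  have hpos : ∀ z ∈ closedBall (0 : ℂ) d, 0 < (P z).re := by
    obtain ⟨m, hm, hmle⟩ : ∃ m, 0 < m ∧ ∀ z ∈ sphere (0 : ℂ) d, m ≤ v z := by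
      obtain ⟨x, hx, hxm⟩ := (isCompact_sphere (0 : ℂ) d).exists_isMinOn
        (NormedSpace.sphere_nonempty.2 hd.le)
        (hvb.mono (sphere_subset_closedBall.trans hsub))
      exact ⟨v x, hv.pos x (hsub (sphere_subset_closedBall hx)), fun z hz => hxm hz⟩
    intro z hz
    exact hm.trans_le
      (le_re_entire_of_sphere hP hd (fun z hz => (hmle z hz).trans (hlow z hz).le) z hz)
  classical
  let v' : ℂ → ℝ := fun z => if z ∈ ball (0 : ℂ) d then min (v z) (P z).re else v z
  have hv'le : ∀ z, v' z ≤ v z := fun z => by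
    by_cases h : z ∈ ball (0 : ℂ) d <;> simp only [v', h, if_true, if_false, le_refl, min_le_left]
  have hin : ∀ z ∈ ball (0 : ℂ) d, v' z = min (v z) (P z).re := fun z hz => if_pos hz
  have hout : ∀ z ∉ ball (0 : ℂ) d, v' z = v z := fun z hz => if_neg hz
  have hminc : ContinuousOn (fun z => min (v z) (P z).re) (ball 0 1) :=
    hvb.inf (by fun_prop)
  have hcont : ContinuousOn v' (closedBall 0 1) := by
    intro z hz
    rcases lt_trichotomy ‖z‖ d with h | h | h
    · have hzd : z ∈ ball (0 : ℂ) d := by simpa using h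
      have hz1 : z ∈ ball (0 : ℂ) 1 := hsub (ball_subset_closedBall hzd)
      refine ContinuousAt.continuousWithinAt ?_
      exact (hminc.continuousAt (isOpen_ball.mem_nhds hz1)).congr
        (by filter_upwards [isOpen_ball.mem_nhds hzd] with y hy using (hin y hy).symm)
    · have hz1 : z ∈ ball (0 : ℂ) 1 := hsub (by simp [h])
      have hvz := hvb.continuousAt (isOpen_ball.mem_nhds hz1)
      refine ContinuousAt.continuousWithinAt (hvz.congr ?_)
      have hlt : ∀ᶠ y in 𝓝 z, v y < (P y).re :=
        hvz.eventually_lt (by fun_prop) (hlow z (by simpa using h))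
      filter_upwards [hlt] with y hy
      by_cases hyd : y ∈ ball (0 : ℂ) d
      · rw [hin y hyd, min_eq_left hy.le]
      · exact (hout y hyd).symm
    · refine (hv.cont z hz).congr_of_eventuallyEq ?_ (hout z (by simpa using h.le))
      have : ∀ᶠ y in 𝓝 z, d < ‖y‖ := continuousAt_const.eventually_lt continuous_norm.continuousAt h
      filter_upwards [nhdsWithin_le_nhds this] with y hy
      exact hout y (by simpa using hy.le)
  have hv'b := hcont.mono ball_subset_closedBall
  refine ⟨v', ⟨?_, ?_, hcont, ?_⟩, ?_⟩
  · refine superharmOn_of_eventually_circleAverage_le isOpen_ball hv'b fun z hz => ?_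
    by_cases hzd : z ∈ ball (0 : ℂ) d
    · filter_upwards [eventually_closedBall_subset_of_isOpen isOpen_ball hzd] with r hr
      have hr1 : closedBall z r ⊆ ball 0 1 := hr.2.trans (ball_subset_closedBall.trans hsub)
      rw [Real.circleAverage_congr_sphere (f₂ := fun z => min (v z) (P z).re), hin z hzd]
      · refine (circleAverage_min_le ?_ ?_ ?_).trans (min_le_min ?_ ?_)
        · exact hvb.circleIntegrable_of_closedBall_subset hr.1.le hr1
        · exact ContinuousOn.circleIntegrable hr.1.le (by fun_prop)
        · exact hminc.circleIntegrable_of_closedBall_subset hr.1.le hr1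
        · exact hv.superharm.circleAverage_le hr.1 hr1
        · exact (circleAverage_re_entire hP z r).le
      · intro y hy
        rw [abs_of_pos hr.1] at hy
        exact hin y (hr.2 (sphere_subset_closedBall hy))
    · filter_upwards [eventually_closedBall_subset_of_isOpen isOpen_ball hz] with r hr
      rw [hout z hzd]
      exact (Real.circleAverage_mono (hv'b.circleIntegrable_of_closedBall_subset hr.1.le hr.2)
        (hvb.circleIntegrable_of_closedBall_subset hr.1.le hr.2) fun y _ => hv'le y).trans
        (hv.superharm.circleAverage_le hr.1 hr.2)
  · intro z hz
    by_cases hzd : z ∈ ball (0 : ℂ) d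
    · rw [hin z hzd]
      exact lt_min (hv.pos z hz) (hpos z (ball_subset_closedBall hzd))
    · rw [hout z hzd]
      exact hv.pos z hz
  · intro z hz
    rw [hout z (hA.notMem_of_mem_left hz)]
    exact hv.one_le z hz
  · intro z hz
    have hzd : z ∈ ball (0 : ℂ) d := ball_subset_ball (by linarith) hz
    have hwd : w ∈ ball (0 : ℂ) d := ball_subset_ball (by linarith) hw
    have hPw : (P w).re < ε := (hup w (ball_subset_closedBall hwd)).trans_lt hκε
    have hPw0 := hpos w (ball_subset_closedBall hwd)
    rw [mem_ball_zero_iff] at hz hw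
    have hzw : ‖z - w‖ < d / 2 := (norm_sub_le z w).trans_lt (by linarith)
    have hball : ball w (3 * d / 4) ⊆ closedBall 0 d := fun y hy => by
      rw [mem_ball_iff_norm] at hy
      rw [mem_closedBall_zero_iff]
      have := norm_add_le (y - w) w
      rw [sub_add_cancel] at this
      linarith
    have hH := norm_sub_le_of_re_pos (R := 3 * d / 4) (w := w) (z := z) hP.differentiableOn
      (fun y hy => hpos y (hball hy)) (by rw [mem_ball_iff_norm]; linarith)
    have h2 : 2 * (P w).re * ‖z - w‖ / (3 * d / 4 - ‖z - w‖) ≤ 4 * ε := by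
      rw [div_le_iff₀ (by linarith)]
      nlinarith [norm_nonneg (z - w)]
    have h3 := (re_le_norm (P z - P w)).trans (hH.trans h2)
    rw [sub_re] at h3
    rw [hin z hzd]
    exact (min_le_right _ _).trans (by linarith)

theorem exists_isBarrier_le_of_hm_lt {A : Set ℂ} {d ε : ℝ} (hd : 0 < d) (hd1 : d < 1)
    (hA : Disjoint A (ball 0 d)) (hε : hm 0 A < ε) :
    ∃ v, IsBarrier A v ∧ ∀ z ∈ ball (0 : ℂ) (d / 4), v z ≤ 5 * ε := by
  obtain ⟨w, hw, hwd⟩ := ((frequently_hmPre_lt hε).and_eventually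
    (ball_mem_nhds (0 : ℂ) (show 0 < d / 4 by linarith))).exists
  obtain ⟨v, hv, hvw⟩ := exists_isBarrier_lt hw
  exact hv.exists_harnack hd hd1 hA hwd hvw

theorem differentiableAt_of_eventually_rightInverse {p q : ℂ → ℂ} {y₀ : ℂ}
    (hp : ∀ᶠ z in 𝓝 (q y₀), DifferentiableAt ℂ p z) (hq : ∀ᶠ y in 𝓝 y₀, ContinuousAt q y)
    (hpq : ∀ᶠ y in 𝓝 y₀, p (q y) = y) : DifferentiableAt ℂ q y₀ := by
  have hqc : ContinuousAt q y₀ := hq.self_of_nhds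
  have han : AnalyticAt ℂ p (q y₀) := analyticAt_iff_eventually_differentiableAt.2 hp
  have hne : ∀ᶠ z in 𝓝[≠] (q y₀), deriv p z ≠ 0 := by
    refine han.deriv.eventually_eq_zero_or_eventually_ne_zero.resolve_left fun h0 => ?_
    obtain ⟨r, hr, hball⟩ := Metric.eventually_nhds_iff_ball.1 (hp.and h0)
    have hconst : ∀ z ∈ ball (q y₀) r, p z = p (q y₀) := fun z hz =>
      isOpen_ball.is_const_of_deriv_eq_zero isPreconnected_ball
        (fun x hx => (hball x hx).1.differentiableWithinAt) (fun x hx => (hball x hx).2) hz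
        (mem_ball_self hr)
    have hy : ∀ᶠ y in 𝓝 y₀, y = y₀ := by
      filter_upwards [hqc (ball_mem_nhds _ hr), hpq] with y h1 h2
      rw [← h2, hconst _ h1, hpq.self_of_nhds]
    have := (hy.filter_mono nhdsWithin_le_nhds).and (self_mem_nhdsWithin (s := {y₀}ᶜ) (a := y₀))
    obtain ⟨y, hy1, hy2⟩ := this.exists
    exact hy2 hy1
  have hd : ∀ᶠ y in 𝓝[≠] y₀, DifferentiableAt ℂ q y := by
    rw [eventually_nhdsWithin_iff] at hne ⊢
    filter_upwards [hqc.eventually hne, hq, hpq.eventually_nhds, hqc.eventually hp]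
      with y h1 h2 h3 h4 hy
    refine (HasDerivAt.of_local_left_inverse h2 h4.hasDerivAt (h1 fun h => hy ?_) h3).differentiableAt
    rw [mem_singleton_iff] at h ⊢
    rw [← h3.self_of_nhds, h, hpq.self_of_nhds]
  exact (analyticAt_of_differentiable_on_punctured_nhds_of_continuousAt hd hqc).differentiableAt

/-- A holomorphic universal covering map of the complement of `A` in the disk by the disk. -/
structure IsDiskCover (A : Set ℂ) (p : ℂ → ℂ) : Prop where
  holo : DifferentiableOn ℂ p (ball 0 1)
  maps : MapsTo p (ball 0 1) (ball 0 1 \ A)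
  surj : SurjOn p (ball 0 1) (ball 0 1 \ A)
  cov : IsCoveringMap (MapsTo.restrict p _ _ maps)
  zero : p 0 = 0

namespace IsDiskCover

variable {A : Set ℂ} {p : ℂ → ℂ}

theorem mapsTo_ball (hp : IsDiskCover A p) : MapsTo p (ball 0 1) (ball 0 1) :=
  fun _ hz => (hp.maps hz).1

theorem differentiableAt (hp : IsDiskCover A p) {z : ℂ} (hz : z ∈ ball (0 : ℂ) 1) :
    DifferentiableAt ℂ p z := hp.holo.differentiableAt (isOpen_ball.mem_nhds hz)

theorem norm_le (hp : IsDiskCover A p) {z : ℂ} (hz : z ∈ ball (0 : ℂ) 1) : ‖p z‖ ≤ ‖z‖ :=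
  norm_le_norm_of_mapsTo_ball hp.holo (fun _ hw => ball_subset_closedBall (hp.mapsTo_ball hw))
    hp.zero (mem_ball_zero_iff.1 hz)

theorem exists_injOn (hp : IsDiskCover A p) {z : ℂ} (hz : z ∈ ball (0 : ℂ) 1) :
    ∃ U ∈ 𝓝 z, U ⊆ ball 0 1 ∧ InjOn p U := by
  obtain ⟨U, hUo, hzU, hinj⟩ := hp.cov.isLocalHomeomorph.isLocallyInjective ⟨z, hz⟩
  refine ⟨(↑) '' U, (isOpen_ball.isOpenMap_subtype_val U hUo).mem_nhds ⟨_, hzU, rfl⟩,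
    by rintro _ ⟨x, _, rfl⟩; exact x.2, ?_⟩
  rintro _ ⟨x, hx, rfl⟩ _ ⟨y, hy, rfl⟩ hxy
  exact congrArg Subtype.val (hinj hx hy (Subtype.ext hxy))

theorem isOpen_diff (hp : IsDiskCover A p) : IsOpen (ball (0 : ℂ) 1 \ A) := by
  have himg : p '' ball 0 1 = ball 0 1 \ A := hp.maps.image_subset.antisymm hp.surj
  rw [← himg]
  refine ((hp.holo.analyticOnNhd isOpen_ball).is_constant_or_isOpen
    isPreconnected_ball).resolve_left ?_ _ Subset.rfl isOpen_ball
  rintro ⟨w, hw⟩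
  obtain ⟨U, hU, hUb, hinj⟩ := hp.exists_injOn (mem_ball_self one_pos)
  have : ∀ᶠ z in 𝓝[≠] (0 : ℂ), z ∈ U ∧ z ≠ 0 :=
    ((Filter.eventually_mem_set.2 hU).filter_mono nhdsWithin_le_nhds).and self_mem_nhdsWithin
  obtain ⟨z, hz, hz0⟩ := this.exists
  exact hz0 (hinj hz (mem_of_mem_nhds hU) (by rw [hw _ (hUb hz), hw 0 (mem_ball_self one_pos)]))

theorem exists_branch (hp : IsDiskCover A p) {N : Set ℂ} (hN : IsOpen N) (hNc : Convex ℝ N)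
    (hNA : N ⊆ ball 0 1 \ A) {z₀ : ℂ} (hz₀ : z₀ ∈ ball (0 : ℂ) 1) (hz₀N : p z₀ ∈ N) :
    ∃ q : ℂ → ℂ, q (p z₀) = z₀ ∧ DifferentiableOn ℂ q N ∧ MapsTo q N (ball 0 1) ∧
      ∀ w ∈ N, p (q w) = w := by
  classical
  have : ContractibleSpace N := hNc.contractibleSpace ⟨_, hz₀N⟩
  have : LocallyPathConnectedSpace N := hN.locallyPathConnectedSpace
  obtain ⟨F, ⟨hF0, hF⟩, -⟩ := hp.cov.existsUnique_continuousMap_lifts (A := N)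
    ⟨fun x => ⟨x.1, hNA x.2⟩, by fun_prop⟩ ⟨p z₀, hz₀N⟩ ⟨z₀, hz₀⟩ rfl
  let q : ℂ → ℂ := fun w => if h : w ∈ N then (F ⟨w, h⟩ : ℂ) else 0
  have hq : ∀ (w) (h : w ∈ N), q w = F ⟨w, h⟩ := fun w h => dif_pos h
  have hqb : MapsTo q N (ball 0 1) := fun w hw => by rw [hq w hw]; exact (F ⟨w, hw⟩).2
  have hpq : ∀ w ∈ N, p (q w) = w := fun w hw => by
    rw [hq w hw]
    exact congrArg Subtype.val (congrFun hF ⟨w, hw⟩)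
  have hqc : ContinuousOn q N := by
    rw [continuousOn_iff_continuous_domRestrict]
    have : N.domRestrict q = fun x => (F x : ℂ) := funext fun x => hq x x.2
    rw [this]
    fun_prop
  refine ⟨q, by rw [hq _ hz₀N, hF0], fun w hw => ?_, hqb, hpq⟩
  refine (differentiableAt_of_eventually_rightInverse (p := p) ?_ ?_ ?_).differentiableWithinAt
  · exact (isOpen_ball.eventually_mem (hqb hw)).mono fun z hz => hp.differentiableAt hz
  · exact (hN.eventually_mem hw).mono fun y hy => hqc.continuousAt (hN.mem_nhds hy)
  · exact (hN.eventually_mem hw).mono hpq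

theorem eventually_branch_comp (hp : IsDiskCover A p) {N : Set ℂ} (hN : IsOpen N) {q : ℂ → ℂ}
    (hq : DifferentiableOn ℂ q N) (hpq : ∀ w ∈ N, p (q w) = w) {z : ℂ} (hz : z ∈ ball (0 : ℂ) 1)
    (hzN : p z ∈ N) (hqz : q (p z) = z) : ∀ᶠ z' in 𝓝 z, q (p z') = z' := by
  obtain ⟨U, hU, hUb, hinj⟩ := hp.exists_injOn hz
  have hpc := (hp.differentiableAt hz).continuousAt
  have hqc := (hq.differentiableAt (hN.mem_nhds hzN)).continuousAt
  have hc : Tendsto (fun z' => q (p z')) (𝓝 z) (𝓝 z) := by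
    have := hqc.tendsto.comp hpc.tendsto
    rwa [hqz] at this
  filter_upwards [hc hU, hU, hpc (hN.mem_nhds hzN)] with z' h1 h2 h3
  exact hinj h1 h2 (hpq _ h3)

theorem exists_local_inverse (hp : IsDiskCover A p) {z : ℂ} (hz : z ∈ ball (0 : ℂ) 1) :
    ∃ b : ℂ → ℂ, (∀ᶠ y in 𝓝 (p z), DifferentiableAt ℂ b y) ∧ (∀ᶠ y in 𝓝 (p z), p (b y) = y) ∧
      (∀ᶠ z' in 𝓝 z, b (p z') = z') := by
  obtain ⟨r, hr, hN⟩ := Metric.isOpen_iff.1 hp.isOpen_diff _ (hp.maps hz)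
  obtain ⟨q, hqz, hqd, hqm, hpq⟩ := hp.exists_branch isOpen_ball (convex_ball _ _) hN hz
    (mem_ball_self hr)
  have hmem : ∀ᶠ y in 𝓝 (p z), y ∈ ball (p z) r := ball_mem_nhds _ hr
  exact ⟨q, hmem.mono fun y hy => hqd.differentiableAt (isOpen_ball.mem_nhds hy), hmem.mono hpq,
    hp.eventually_branch_comp isOpen_ball hqd hpq hz (mem_ball_self hr) hqz⟩

theorem circleAverage_comp_le (hp : IsDiskCover A p) {v : ℂ → ℝ} (hv : SuperharmOn v (ball 0 1))
    (hvc : ContinuousOn v (ball 0 1)) {c : ℂ} {R : ℝ} (hR : 0 < R)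
    (hc : closedBall c R ⊆ ball 0 1) : Real.circleAverage (fun z => v (p z)) c R ≤ v (p c) :=
  _root_.circleAverage_comp_le hR hv hvc (hp.holo.continuousOn.mono hc)
    (fun _ hz => hp.mapsTo_ball (hc hz))
    fun _ hz => hp.exists_local_inverse (hc (ball_subset_closedBall hz))

theorem circleAverage_comp_branch_le (hp : IsDiskCover A p) {v : ℂ → ℝ}
    (hv : SuperharmOn v (ball 0 1)) (hvc : ContinuousOn v (ball 0 1)) {N : Set ℂ} (hN : IsOpen N)
    {q : ℂ → ℂ} (hq : DifferentiableOn ℂ q N) (hqm : MapsTo q N (ball 0 1))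
    (hpq : ∀ w ∈ N, p (q w) = w) {c : ℂ} {R : ℝ} (hR : 0 < R) (hc : closedBall c R ⊆ N) :
    Real.circleAverage (fun z => v (q z)) c R ≤ v (q c) := by
  refine _root_.circleAverage_comp_le hR hv hvc (hq.continuousOn.mono hc)
    (fun _ hz => hqm (hc hz)) fun z hz => ⟨p, ?_, ?_, ?_⟩
  · have hzN := hc (ball_subset_closedBall hz)
    exact (isOpen_ball.eventually_mem (hqm hzN)).mono fun y hy => hp.differentiableAt hy
  · have hzN := hc (ball_subset_closedBall hz)
    have hpqz := hpq z hzN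
    exact hp.eventually_branch_comp hN hq hpq (hqm hzN) (by rwa [hpqz]) (by rw [hpqz])
  · exact (hN.eventually_mem (hc (ball_subset_closedBall hz))).mono hpq

theorem norm_deriv_branch_le (hp : IsDiskCover A p) {q : ℂ → ℂ} {w : ℂ} {s : ℝ} (hs : 0 < s)
    (hq : DifferentiableOn ℂ q (ball w s)) (hqm : MapsTo q (ball w s) (ball 0 1))
    (hpq : p (q w) = w) : ‖deriv q w‖ ≤ 2 * (1 - ‖w‖) / s := by
  obtain ⟨α, hα, hαq⟩ : ∃ α : ℂ, ‖α‖ = 1 ∧ α * q w = ‖q w‖ := by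
    rcases eq_or_ne (q w) 0 with h | h
    · exact ⟨1, by simp, by simp [h]⟩
    · have h' : (‖q w‖ : ℂ) ≠ 0 := by simpa using h
      refine ⟨‖q w‖ / q w, by simp [h], by field_simp⟩
  have hww : w ∈ ball w s := mem_ball_self hs
  have hqd := hq.differentiableAt (isOpen_ball.mem_nhds hww)
  have := norm_deriv_le_of_re_pos (g := fun z => 1 - α * q z) (w := w) hs
    ((hq.const_mul α).const_sub 1) ?_
  · have hder : deriv (fun z => 1 - α * q z) w = - (α * deriv q w) := by
      rw [deriv_const_sub, deriv_const_mul _ hqd]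
    rw [hder, norm_neg, norm_mul, hα, one_mul, hαq] at this
    refine this.trans ?_
    have hle : ‖w‖ ≤ ‖q w‖ := by
      conv_lhs => rw [← hpq]
      exact hp.norm_le (hqm hww)
    simp only [sub_re, one_re, ofReal_re]
    gcongr
  · intro z hz
    have h1 := (re_le_norm (α * q z)).trans_lt
      (by rw [norm_mul, hα, one_mul]; exact mem_ball_zero_iff.1 (hqm hz))
    simpa using h1

/-- Over a ball missing `A`, the cover has equi-Lipschitz holomorphic sections. -/
theorem exists_branch_lipschitz (hp : IsDiskCover A p) {x : ℂ} {ρ : ℝ}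
    (hN : ball x ρ ∩ ball 0 1 ⊆ ball 0 1 \ A) {z₀ : ℂ} (hz₀ : z₀ ∈ ball (0 : ℂ) 1)
    (hz₀N : p z₀ ∈ ball x ρ) :
    ∃ q : ℂ → ℂ, q (p z₀) = z₀ ∧ DifferentiableOn ℂ q (ball x ρ ∩ ball 0 1) ∧
      MapsTo q (ball x ρ ∩ ball 0 1) (ball 0 1) ∧ (∀ w ∈ ball x ρ ∩ ball 0 1, p (q w) = w) ∧
      ∀ a ∈ ball x (ρ / 2) ∩ ball 0 1, ∀ b ∈ ball x (ρ / 2) ∩ ball 0 1,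
        ‖q b - q a‖ ≤ (2 + 4 / ρ) * ‖b - a‖ := by
  have hNo : IsOpen (ball x ρ ∩ ball (0 : ℂ) 1) := isOpen_ball.inter isOpen_ball
  have hρ : 0 < ρ := pos_of_mem_ball hz₀N
  obtain ⟨q, hqz, hqd, hqm, hpq⟩ := hp.exists_branch hNo
    ((convex_ball _ _).inter (convex_ball _ _)) hN hz₀ ⟨hz₀N, hp.mapsTo_ball hz₀⟩
  have hsub : ball x (ρ / 2) ∩ ball (0 : ℂ) 1 ⊆ ball x ρ ∩ ball 0 1 :=
    inter_subset_inter_left _ (ball_subset_ball (by linarith))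
  refine ⟨q, hqz, hqd, hqm, hpq, fun a ha b hb => ?_⟩
  refine Convex.norm_image_sub_le_of_norm_deriv_le (𝕜 := ℂ)
    (fun w hw => hqd.differentiableAt (hNo.mem_nhds (hsub hw))) (fun w hw => ?_)
    ((convex_ball _ _).inter (convex_ball _ _)) ha hb
  have hw1 : ‖w‖ < 1 := mem_ball_zero_iff.1 hw.2
  have hs : 0 < min (ρ / 2) (1 - ‖w‖) := lt_min (by linarith) (by linarith)
  have hball : ball w (min (ρ / 2) (1 - ‖w‖)) ⊆ ball x ρ ∩ ball 0 1 := by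
    intro y hy
    obtain ⟨h1, h2⟩ := lt_min_iff.1 (mem_ball.1 hy)
    refine ⟨?_, ?_⟩
    · have := dist_triangle y w x
      have h3 := mem_ball.1 hw.1
      rw [mem_ball]
      linarith
    · rw [dist_eq_norm] at h2
      have := norm_add_le (y - w) w
      rw [sub_add_cancel] at this
      rw [mem_ball_zero_iff]
      linarith
  refine (hp.norm_deriv_branch_le hs (hqd.mono hball) (hqm.mono_left hball)
    (hpq w (hsub hw))).trans ?_
  rw [div_le_iff₀ hs]
  rcases min_cases (ρ / 2) (1 - ‖w‖) with h | h
  · rw [h.1]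
    have : (2 + 4 / ρ) * (ρ / 2) = ρ + 2 := by field_simp; ring
    rw [this]
    linarith [norm_nonneg w]
  · rw [h.1]
    have : 0 < 4 / ρ := by positivity
    nlinarith
end IsDiskCover

namespace IsDiskCover

variable {A : Set ℂ} {p : ℂ → ℂ}

theorem exists_disjoint_ball (hp : IsDiskCover A p) :
    ∃ d, 0 < d ∧ d < 1 ∧ Disjoint A (ball 0 d) := by
  have h0 := hp.maps (mem_ball_self one_pos)
  rw [hp.zero] at h0
  obtain ⟨r, hr, hN⟩ := Metric.isOpen_iff.1 hp.isOpen_diff _ h0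
  refine ⟨min r (1 / 2), by positivity, (min_le_right _ _).trans_lt (by norm_num), ?_⟩
  exact disjoint_right.2 fun x hx => (hN (ball_subset_ball (min_le_left _ _) hx)).2

theorem fiber_nonempty (hp : IsDiskCover A p) {w : ℂ} (hw : w ∈ ball (0 : ℂ) 1 \ A) :
    (p ⁻¹' {w} ∩ ball 0 1).Nonempty := by
  obtain ⟨z, hz, rfl⟩ := hp.surj hw
  exact ⟨z, rfl, hz⟩

end IsDiskCover

/-- The push-forward of `v` under `p`, corrected by `u` and truncated at `1`. -/
noncomputable def fiberInf (p : ℂ → ℂ) (v u : ℂ → ℝ) (w : ℂ) : ℝ :=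
  min 1 (sInf (v '' (p ⁻¹' {w} ∩ ball 0 1)) + 2 * u w)

section fiberInf

variable {A B : Set ℂ} {p : ℂ → ℂ} {u v : ℂ → ℝ}

theorem fiberInf_le_one (p : ℂ → ℂ) (v u : ℂ → ℝ) (w : ℂ) : fiberInf p v u w ≤ 1 := min_le_left _ _

theorem sInf_fiber_nonneg (hv : IsBarrier B v) (w : ℂ) :
    0 ≤ sInf (v '' (p ⁻¹' {w} ∩ ball 0 1)) := by
  refine Real.sInf_nonneg ?_
  rintro _ ⟨z, hz, rfl⟩
  exact (hv.pos z hz.2).le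

theorem fiberInf_le (hv : IsBarrier B v) {z : ℂ} (hz : z ∈ ball (0 : ℂ) 1) :
    fiberInf p v u (p z) ≤ v z + 2 * u (p z) := by
  have hb : BddBelow (v '' (p ⁻¹' {p z} ∩ ball 0 1)) := ⟨0, ?_⟩
  · linarith [min_le_right 1 (sInf (v '' (p ⁻¹' {p z} ∩ ball 0 1)) + 2 * u (p z)),
      csInf_le hb ⟨z, ⟨rfl, hz⟩, rfl⟩, fiberInf.eq_1 p v u (p z)]
  rintro _ ⟨z, hz, rfl⟩
  exact (hv.pos z hz.2).le

theorem le_fiberInf (hp : IsDiskCover A p) {w : ℂ} {c : ℝ} (hw : w ∈ ball (0 : ℂ) 1 \ A)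
    (hc : c ≤ 1) (h : ∀ z ∈ ball (0 : ℂ) 1, p z = w → c ≤ v z + 2 * u w) :
    c ≤ fiberInf p v u w := by
  refine le_min hc (sub_le_iff_le_add.1 (le_csInf ((hp.fiber_nonempty hw).image v) ?_))
  rintro _ ⟨z, hz, rfl⟩
  exact sub_le_iff_le_add.2 (h z hz.2 hz.1)

theorem fiberInf_eq_one (hv : IsBarrier B v) {w : ℂ} (h : 1 ≤ 2 * u w) : fiberInf p v u w = 1 :=
  min_eq_left (by linarith [sInf_fiber_nonneg (p := p) hv w])

theorem IsBarrier.one_le_closure (hu : IsBarrier A u) (hA : A ⊆ ball 0 1) {x : ℂ}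
    (hx : x ∈ closure A) : 1 ≤ u x := by
  refine le_on_closure (f := fun _ => (1 : ℝ)) hu.one_le continuousOn_const (hu.cont.mono ?_) hx
  exact closure_minimal (hA.trans ball_subset_closedBall) isClosed_closedBall

theorem fiberInf_cauchy (hp : IsDiskCover A p) (hA : A ⊆ ball 0 1) (hu : IsBarrier A u)
    (hv : IsBarrier B v) {x : ℂ} (hx : x ∈ closedBall (0 : ℂ) 1) {η : ℝ} (hη : 0 < η) :
    ∃ r > 0, ∀ a ∈ ball x r ∩ ball 0 1, ∀ b ∈ ball x r ∩ ball 0 1,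
      fiberInf p v u b ≤ fiberInf p v u a + 3 * η := by
  by_cases hxA : x ∈ closure A
  · have h1 := hu.one_le_closure hA hxA
    have h2 : ∀ᶠ y in 𝓝[closedBall 0 1] x, 1 / 2 < u y :=
      (hu.cont x hx).eventually (lt_mem_nhds (by linarith))
    obtain ⟨r, hr, h⟩ := Metric.mem_nhdsWithin_iff.1 h2
    refine ⟨r, hr, fun a ha b hb => ?_⟩
    have key : ∀ a ∈ ball x r ∩ ball (0 : ℂ) 1, fiberInf p v u a = 1 := fun a ha =>
      fiberInf_eq_one hv (by
        have : 1 / 2 < u a := h ⟨ha.1, ball_subset_closedBall ha.2⟩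
        linarith)
    rw [key a ha, key b hb]
    linarith
  · obtain ⟨ρ, hρ, hρA⟩ := Metric.isOpen_iff.1 isClosed_closure.isOpen_compl x hxA
    have hN : ball x ρ ∩ ball (0 : ℂ) 1 ⊆ ball 0 1 \ A := fun y hy =>
      ⟨hy.2, fun hyA => hρA hy.1 (subset_closure hyA)⟩
    have hcpt := isCompact_closedBall (0 : ℂ) 1
    obtain ⟨κ₁, hκ₁, hv₁⟩ := Metric.uniformContinuousOn_iff.1
      (hcpt.uniformContinuousOn_of_continuous hv.cont) η hη
    obtain ⟨κ₂, hκ₂, hu₂⟩ := Metric.uniformContinuousOn_iff.1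
      (hcpt.uniformContinuousOn_of_continuous hu.cont) η hη
    have hC : 0 < 2 + 4 / ρ := by positivity
    obtain ⟨r, hr, hrρ, hr₁, hr₂⟩ : ∃ r > 0, r ≤ ρ / 2 ∧ (2 + 4 / ρ) * (2 * r) ≤ κ₁ ∧
        2 * r ≤ κ₂ := by
      refine ⟨min (ρ / 2) (min (κ₁ / (2 + 4 / ρ) / 2) (κ₂ / 2)), by positivity, min_le_left _ _,
        ?_, ?_⟩
      · have : min (ρ / 2) (min (κ₁ / (2 + 4 / ρ) / 2) (κ₂ / 2)) ≤ κ₁ / (2 + 4 / ρ) / 2 :=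
          (min_le_right _ _).trans (min_le_left _ _)
        calc _ ≤ (2 + 4 / ρ) * (2 * (κ₁ / (2 + 4 / ρ) / 2)) := by gcongr
          _ = κ₁ := by field_simp
      · have : min (ρ / 2) (min (κ₁ / (2 + 4 / ρ) / 2) (κ₂ / 2)) ≤ κ₂ / 2 :=
          (min_le_right _ _).trans (min_le_right _ _)
        linarith
    have hsub : ∀ a ∈ ball x r ∩ ball (0 : ℂ) 1, a ∈ ball x ρ ∩ ball (0 : ℂ) 1 := fun a ha =>
      ⟨ball_subset_ball (by linarith) ha.1, ha.2⟩
    refine ⟨r, hr, fun a ha b hb => sub_le_iff_le_add.1 ?_⟩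
    refine le_fiberInf hp (hN (hsub a ha)) ?_ fun z hz hza => ?_
    · linarith [fiberInf_le_one p v u b]
    obtain ⟨q, hqz, -, hqm, hpq, hlip⟩ := hp.exists_branch_lipschitz hN hz
      (by rw [hza]; exact (hsub a ha).1)
    rw [hza] at hqz
    have hab : dist b a < 2 * r := by
      have := dist_triangle_right b a x
      linarith [mem_ball.1 ha.1, mem_ball.1 hb.1]
    have hq₁ : dist (q b) z < κ₁ := by
      rw [← hqz, dist_eq_norm]
      refine (hlip a ⟨ball_subset_ball hrρ ha.1, ha.2⟩ b
        ⟨ball_subset_ball hrρ hb.1, hb.2⟩).trans_lt ?_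
      rw [← dist_eq_norm]
      exact (mul_lt_mul_of_pos_left hab hC).trans_le hr₁
    have hqb := hqm (hsub b hb)
    have h1 := abs_lt.1 (hv₁ _ (ball_subset_closedBall hqb) _ (ball_subset_closedBall hz) hq₁)
    have h2 := abs_lt.1 (hu₂ _ (ball_subset_closedBall hb.2) _ (ball_subset_closedBall ha.2)
      (hab.trans_le hr₂))
    have h3 := fiberInf_le (p := p) (u := u) hv hqb
    rw [hpq b (hsub b hb)] at h3
    linarith

theorem fiberInf_continuousOn (hp : IsDiskCover A p) (hA : A ⊆ ball 0 1) (hu : IsBarrier A u)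
    (hv : IsBarrier B v) : ContinuousOn (fiberInf p v u) (ball 0 1) := by
  intro x hx
  refine Metric.continuousWithinAt_iff.2 fun η hη => ?_
  obtain ⟨r, hr, h⟩ := fiberInf_cauchy hp hA hu hv (ball_subset_closedBall hx)
    (show 0 < η / 4 by positivity)
  refine ⟨r, hr, fun y hy hyx => ?_⟩
  have h1 := h x ⟨mem_ball_self hr, hx⟩ y ⟨hyx, hy⟩
  have h2 := h y ⟨hyx, hy⟩ x ⟨mem_ball_self hr, hx⟩
  rw [Real.dist_eq, abs_lt]
  constructor <;> linarith

theorem exists_tendsto_fiberInf (hp : IsDiskCover A p) (hA : A ⊆ ball 0 1) (hu : IsBarrier A u)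
    (hv : IsBarrier B v) {x : ℂ} (hx : x ∈ closedBall (0 : ℂ) 1) :
    ∃ y, Tendsto (fiberInf p v u) (𝓝[ball 0 1] x) (𝓝 y) := by
  have : (𝓝[ball (0 : ℂ) 1] x).NeBot := by
    rw [← mem_closure_iff_nhdsWithin_neBot, closure_ball _ one_ne_zero]
    exact hx
  rw [← cauchy_map_iff_exists_tendsto, Metric.cauchy_iff]
  refine ⟨inferInstance, fun η hη => ?_⟩
  obtain ⟨r, hr, h⟩ := fiberInf_cauchy hp hA hu hv hx (show 0 < η / 4 by positivity)
  refine ⟨_, image_mem_map (inter_mem_nhdsWithin _ (ball_mem_nhds x hr)), ?_⟩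
  rintro _ ⟨a, ha, rfl⟩ _ ⟨b, hb, rfl⟩
  have h1 := h a ha.symm b hb.symm
  have h2 := h b hb.symm a ha.symm
  rw [Real.dist_eq, abs_lt]
  constructor <;> linarith

theorem fiberInf_superharmOn (hp : IsDiskCover A p) (hA : A ⊆ ball 0 1) (hu : IsBarrier A u)
    (hv : IsBarrier B v) : SuperharmOn (fiberInf p v u) (ball 0 1) := by
  have hc := fiberInf_continuousOn hp hA hu hv
  refine superharmOn_of_eventually_circleAverage_le isOpen_ball hc fun w hw => ?_
  have hone : ∀ᶠ r in 𝓝[>] (0 : ℝ), Real.circleAverage (fiberInf p v u) w r ≤ 1 := by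
    filter_upwards [eventually_closedBall_subset_of_isOpen isOpen_ball hw] with r hr
    exact Real.circleAverage_mono_on_of_le_circle
      (hc.circleIntegrable_of_closedBall_subset hr.1.le hr.2) fun y _ => fiberInf_le_one p v u y
  by_cases hwA : w ∈ A
  · rw [fiberInf_eq_one hv (by linarith [hu.one_le w hwA])]
    exact hone
  · obtain ⟨ρ, hρ, hρA⟩ := Metric.isOpen_iff.1 hp.isOpen_diff w ⟨hw, hwA⟩
    have hN : ball w ρ ∩ ball (0 : ℂ) 1 ⊆ ball 0 1 \ A := fun y hy => hρA hy.1
    have hNo : IsOpen (ball w ρ ∩ ball (0 : ℂ) 1) := isOpen_ball.inter isOpen_ball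
    have hub := hu.cont.mono ball_subset_closedBall
    have hvb := hv.cont.mono ball_subset_closedBall
    filter_upwards [hone, eventually_closedBall_subset_of_isOpen hNo ⟨mem_ball_self hρ, hw⟩]
      with r hr1 hr
    refine le_fiberInf hp ⟨hw, hwA⟩ hr1 fun z hz hzw => ?_
    obtain ⟨q, hqz, hqd, hqm, hpq, -⟩ := hp.exists_branch_lipschitz hN hz
      (by rw [hzw]; exact mem_ball_self hρ)
    rw [hzw] at hqz
    have hrb := hr.2.trans inter_subset_right
    have hi1 : CircleIntegrable (fun y => v (q y)) w r :=
      ContinuousOn.circleIntegrable_of_closedBall_subset (hvb.comp hqd.continuousOn hqm) hr.1.le hr.2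
    have hi2 : CircleIntegrable u w r := hub.circleIntegrable_of_closedBall_subset hr.1.le hrb
    have hi3 : CircleIntegrable (fun y => 2 * u y) w r :=
      (continuousOn_const.mul hub).circleIntegrable_of_closedBall_subset hr.1.le hrb
    calc Real.circleAverage (fiberInf p v u) w r
        ≤ Real.circleAverage (fun y => v (q y) + 2 * u y) w r := by
          refine Real.circleAverage_mono (hc.circleIntegrable_of_closedBall_subset hr.1.le hrb)
            (hi1.add hi3) fun y hy => ?_
          rw [abs_of_pos hr.1] at hy
          have hy' := hr.2 (sphere_subset_closedBall hy)
          have := fiberInf_le (p := p) (u := u) hv (hqm hy')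
          rwa [hpq y hy'] at this
      _ = Real.circleAverage (fun y => v (q y)) w r + 2 * Real.circleAverage u w r := by
          rw [Real.circleAverage_fun_add hi1 hi3]
          congr 1
          exact Real.circleAverage_fun_smul (a := (2 : ℝ)) (f := u)
      _ ≤ v (q w) + 2 * u w := by
          have h1 := hp.circleAverage_comp_branch_le hv.superharm hvb hNo hqd hqm hpq hr.1 hr.2
          have h2 := hu.superharm.circleAverage_le hr.1 hrb
          linarith
      _ = v z + 2 * u w := by rw [hqz]

theorem exists_isBarrier_pushforward (hp : IsDiskCover A p) (hA : A ⊆ ball 0 1) {E : Set ℂ}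
    (hE : E ⊆ ball 0 1) (hu : IsBarrier A u) (hv : IsBarrier (p ⁻¹' E ∩ ball 0 1) v) :
    ∃ W, IsBarrier E W ∧ ∀ z ∈ ball (0 : ℂ) 1, W (p z) ≤ v z + 2 * u (p z) := by
  have hc := fiberInf_continuousOn hp hA hu hv
  have heq : ∀ x ∈ ball (0 : ℂ) 1, extendFrom (ball 0 1) (fiberInf p v u) x = fiberInf p v u x :=
    fun x hx => extendFrom_eq (subset_closure hx) (hc x hx)
  have hcont : ContinuousOn (extendFrom (ball 0 1) (fiberInf p v u)) (closedBall 0 1) :=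
    continuousOn_extendFrom (by rw [closure_ball _ one_ne_zero])
      fun x hx => exists_tendsto_fiberInf hp hA hu hv hx
  refine ⟨extendFrom (ball 0 1) (fiberInf p v u), ⟨?_, ?_, hcont, ?_⟩, fun z hz => ?_⟩
  · have hs := fiberInf_superharmOn hp hA hu hv
    refine superharmOn_of_eventually_circleAverage_le isOpen_ball
      (hcont.mono ball_subset_closedBall) fun z hz => ?_
    filter_upwards [eventually_closedBall_subset_of_isOpen isOpen_ball hz] with r hr
    rw [heq z hz, Real.circleAverage_congr_sphere (f₂ := fiberInf p v u)]
    · exact hs.circleAverage_le hr.1 hr.2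
    · intro y hy
      rw [abs_of_pos hr.1] at hy
      exact heq y (hr.2 (sphere_subset_closedBall hy))
  · intro w hw
    rw [heq w hw]
    exact lt_min one_pos (by linarith [sInf_fiber_nonneg (p := p) hv w, hu.pos w hw])
  · intro w hw
    rw [heq w (hE hw)]
    by_cases hwA : w ∈ A
    · exact (fiberInf_eq_one hv (by linarith [hu.one_le w hwA])).ge
    · refine le_fiberInf hp ⟨hE hw, hwA⟩ le_rfl fun z hz hzw => ?_
      have := hv.one_le z ⟨by rw [mem_preimage, hzw]; exact hw, hz⟩
      linarith [hu.pos w (hE hw)]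
  · rw [heq _ (hp.mapsTo_ball hz)]
    exact fiberInf_le hv hz

end fiberInf

theorem IsDiskCover.hm_le {A : Set ℂ} {p : ℂ → ℂ} (hp : IsDiskCover A p) (hA : A ⊆ ball 0 1)
    {E : Set ℂ} (hE : E ⊆ ball 0 1) : hm 0 E ≤ hm 0 (p ⁻¹' E ∩ ball 0 1) + 10 * hm 0 A := by
  suffices h : ∀ ε, hm 0 A < ε → hm 0 E ≤ hm 0 (p ⁻¹' E ∩ ball 0 1) + 10 * ε by
    refine le_of_forall_pos_le_add fun δ hδ => ?_
    linarith [h (hm 0 A + δ / 10) (by linarith)]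
  intro ε hε
  obtain ⟨d, hd, hd1, hAd⟩ := hp.exists_disjoint_ball
  obtain ⟨u, hu, hule⟩ := exists_isBarrier_le_of_hm_lt hd hd1 hAd hε
  have hp0 : Tendsto p (𝓝 0) (𝓝 0) := by
    have := (hp.differentiableAt (mem_ball_self one_pos)).continuousAt.tendsto
    rwa [hp.zero] at this
  refine hm_le_add_of_comp hp0 ?_
  filter_upwards [ball_mem_nhds (0 : ℂ) (show 0 < d / 4 by linarith)] with z hz
  have hz1 : z ∈ ball (0 : ℂ) 1 := ball_subset_ball (by linarith) hz
  rw [← sub_le_iff_le_add]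
  refine le_hmPre fun v hv => ?_
  obtain ⟨W, hW, hWle⟩ := exists_isBarrier_pushforward hp hA hE hu hv
  have h1 := hmPre_le hW (hp.mapsTo_ball hz1)
  have h2 := hule (p z) (by
    rw [mem_ball_zero_iff] at hz ⊢
    exact (hp.norm_le hz1).trans_lt hz)
  linarith [hWle z hz1]

section Fatou

variable {E : Type*} [NormedAddCommGroup E] [NormedSpace ℂ E]

theorem eventually_norm_le_mul_of_hasDerivAt_circleMap {H : ℂ → E} {θ₀ : ℝ}
    (h0 : H (circleMap 0 1 θ₀) = 0) (hH : HasDerivAt (fun θ : ℝ => H (circleMap 0 1 θ)) 0 θ₀)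
    {ε : ℝ} (hε : 0 < ε) : ∃ δ > 0, ∀ ξ ∈ sphere (0 : ℂ) 1, ‖ξ - circleMap 0 1 θ₀‖ < δ →
      ‖H ξ‖ ≤ ε * ‖ξ - circleMap 0 1 θ₀‖ := by
  set ζ := circleMap 0 1 θ₀ with hζ
  have hζ1 : ‖ζ‖ = 1 := by simp [hζ]
  have hζ0 : ζ ≠ 0 := norm_ne_zero_iff.1 (by simp [hζ1])
  have ho := (hasDerivAt_iff_isLittleO.1 hH).def (half_pos hε)
  simp only [smul_zero, sub_zero] at ho
  obtain ⟨δ, hδ, hδ'⟩ := Metric.eventually_nhds_iff.1 ho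
  refine ⟨δ / 2, by positivity, fun ξ hξ hd => ?_⟩
  have hξ1 : ‖ξ‖ = 1 := by simpa using hξ
  have hξ0 : ξ ≠ 0 := norm_ne_zero_iff.1 (by simp [hξ1])
  have harg : |(ξ / ζ).arg| ≤ 2 * ‖ξ - ζ‖ := by
    rw [← Complex.angle_eq_abs_arg hξ0 hζ0]
    refine (Complex.angle_le_mul_norm_sub hξ1 hζ1).trans ?_
    gcongr
    linarith [Real.pi_le_four]
  have hcm : circleMap 0 1 (θ₀ + (ξ / ζ).arg) = ξ := by
    have h1 : Complex.exp ((ξ / ζ).arg * I) = ξ / ζ := by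
      have := Complex.norm_mul_exp_arg_mul_I (ξ / ζ)
      simpa [hξ1, hζ1] using this
    have h2 : Complex.exp (θ₀ * I) = ζ := by simp [hζ, circleMap]
    simp only [circleMap, ofReal_add, add_mul, Complex.exp_add, h1, h2]
    field_simp
    simp
  have := hδ' (y := θ₀ + (ξ / ζ).arg) (by
    simp only [dist_self_add_left, Real.norm_eq_abs]
    linarith)
  rw [hcm, ← hζ, h0, sub_zero, add_sub_cancel_left, Real.norm_eq_abs] at this
  nlinarith

theorem exists_norm_le_mul_re_of_hasDerivAt_circleMap {H : ℂ → E} {θ₀ K : ℝ}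
    (hK : ∀ z, ‖H z‖ ≤ K * ‖z - circleMap 0 1 θ₀‖)
    (hH : HasDerivAt (fun θ : ℝ => H (circleMap 0 1 θ)) 0 θ₀)
    {ε : ℝ} (hε : 0 < ε) : ∃ C : ℝ, 0 ≤ C ∧ ∀ ξ ∈ sphere (0 : ℂ) 1,
      ‖H ξ‖ ≤ ‖ξ - circleMap 0 1 θ₀‖ *
        (ε + C * (1 - (starRingEnd ℂ) (circleMap 0 1 θ₀) * ξ)).re := by
  obtain ⟨δ, hδ, hd⟩ := eventually_norm_le_mul_of_hasDerivAt_circleMap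
    (norm_le_zero_iff.1 ((hK _).trans (by simp))) hH hε
  set ζ := circleMap 0 1 θ₀ with hζ
  have hζ1 : ‖ζ‖ = 1 := by simp [hζ]
  refine ⟨2 * |K| / δ ^ 2, by positivity, fun ξ hξ => ?_⟩
  have hξ1 : ‖ξ‖ = 1 := by simpa using hξ
  have hre : (1 - (starRingEnd ℂ) ζ * ξ).re = ‖ξ - ζ‖ ^ 2 / 2 := by
    have h1 := Complex.sq_norm_sub_sq_re ξ
    have h2 := Complex.sq_norm_sub_sq_re ζ
    rw [hξ1] at h1
    rw [hζ1] at h2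
    rw [Complex.sq_norm, Complex.normSq_apply]
    simp only [sub_re, one_re, mul_re, conj_re, conj_im, sub_im]
    nlinarith
  have hsum : (ε + (2 * |K| / δ ^ 2 : ℝ) * (1 - (starRingEnd ℂ) ζ * ξ)).re
      = ε + |K| / δ ^ 2 * ‖ξ - ζ‖ ^ 2 := by
    rw [add_re, re_ofReal_mul, hre, ofReal_re]
    ring
  rw [hsum]
  have hpos : 0 ≤ |K| / δ ^ 2 * ‖ξ - ζ‖ ^ 2 := by positivity
  rcases lt_or_ge ‖ξ - ζ‖ δ with h | h
  · refine (hd ξ hξ h).trans ?_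
    rw [mul_comm]
    gcongr
    linarith
  · refine (hK ξ).trans ?_
    rw [mul_comm]
    gcongr
    have h2 : 1 ≤ ‖ξ - ζ‖ ^ 2 / δ ^ 2 := by
      rw [one_le_div (by positivity)]
      gcongr
    calc K ≤ |K| * 1 := by rw [mul_one]; exact le_abs_self K
      _ ≤ |K| * (‖ξ - ζ‖ ^ 2 / δ ^ 2) := by gcongr
      _ = |K| / δ ^ 2 * ‖ξ - ζ‖ ^ 2 := by ring
      _ ≤ _ := by linarith

theorem norm_le_mul_re_of_sphere [CompleteSpace E] {H : ℂ → E} {ζ : ℂ} {P : ℂ → ℂ} (hζ : ‖ζ‖ = 1)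
    (hH : DiffContOnCl ℂ H (ball 0 1)) (hP : Differentiable ℂ P)
    (hle : ∀ ξ ∈ sphere (0 : ℂ) 1, ‖H ξ‖ ≤ ‖ξ - ζ‖ * (P ξ).re)
    (hP0 : ∀ ξ ∈ sphere (0 : ℂ) 1, 0 ≤ (P ξ).re) {z : ℂ} (hz : z ∈ closedBall (0 : ℂ) 1) :
    ‖H z‖ ≤ ‖z - ζ‖ * (P z).re := by
  have key : ∀ s : ℝ, 1 < s → ‖H z‖ ≤ ‖z - s * ζ‖ * (P z).re := by
    intro s hs
    have hne : ∀ w ∈ closedBall (0 : ℂ) 1, w - s * ζ ≠ 0 := by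
      intro w hw h
      rw [sub_eq_zero] at h
      have : ‖w‖ = s := by rw [h]; simp [hζ, abs_of_pos (one_pos.trans hs)]
      rw [mem_closedBall_zero_iff] at hw
      linarith
    have hd : DiffContOnCl ℂ (fun w => (w - s * ζ)⁻¹ • H w) (ball 0 1) := by
      refine DiffContOnCl.smul (DiffContOnCl.inv ?_ ?_) hH
      · exact (differentiable_id.sub_const _).diffContOnCl
      · rwa [closure_ball _ one_ne_zero]
    have := norm_le_re_entire_of_sphere one_pos hd hP ?_ z hz
    · rw [norm_smul, norm_inv, inv_mul_le_iff₀ (norm_pos_iff.2 (hne z hz))] at this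
      exact this
    · intro ξ hξ
      rw [norm_smul, norm_inv,
        inv_mul_le_iff₀ (norm_pos_iff.2 (hne ξ (sphere_subset_closedBall hξ)))]
      refine (hle ξ hξ).trans (mul_le_mul_of_nonneg_right ?_ (hP0 ξ hξ))
      have hξ1 : ‖ξ‖ = 1 := by simpa using hξ
      have h1 := Complex.sq_norm_sub_sq_re ξ
      have h2 := Complex.sq_norm_sub_sq_re ζ
      have h3 : ξ.re * ζ.re + ξ.im * ζ.im ≤ 1 := by
        rw [hξ1] at h1
        rw [hζ] at h2
        nlinarith [sq_nonneg (ξ.re - ζ.re), sq_nonneg (ξ.im - ζ.im)]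
      refine le_of_sq_le_sq ?_ (norm_nonneg _)
      rw [hξ1] at h1
      rw [hζ] at h2
      rw [Complex.sq_norm, Complex.sq_norm, Complex.normSq_apply, Complex.normSq_apply]
      simp only [sub_re, sub_im, re_ofReal_mul, im_ofReal_mul]
      have h4 : s ^ 2 * (ζ.re ^ 2 + ζ.im ^ 2) = s ^ 2 := by rw [← h2]; ring
      nlinarith [mul_nonneg (sub_nonneg.2 hs.le) (sub_nonneg.2 h3), sq_nonneg (s - 1)]
  have ht : Tendsto (fun s : ℝ => ‖z - s * ζ‖ * (P z).re) (𝓝[>] 1) (𝓝 (‖z - (1 : ℝ) * ζ‖ * (P z).re)) := by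
    refine Tendsto.mono_left ?_ nhdsWithin_le_nhds
    exact Continuous.tendsto (by fun_prop) 1
  rw [ofReal_one, one_mul] at ht
  exact ge_of_tendsto ht (eventually_mem_nhdsWithin.mono fun s hs => key s hs)

theorem exists_tendsto_radial_of_differentiableAt [CompleteSpace E] {f G : ℂ → E} {K : NNReal}
    (hG : LipschitzWith K G) (hd : ∀ z ∈ ball (0 : ℂ) 1, HasDerivAt G (f z) z) {θ₀ : ℝ}
    (hθ : DifferentiableAt ℝ (fun θ : ℝ => G (circleMap 0 1 θ)) θ₀) :
    ∃ l, Tendsto (fun r : ℝ => f (r * circleMap 0 1 θ₀)) (𝓝[<] 1) (𝓝 l) := by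
  set ζ := circleMap 0 1 θ₀ with hζ
  have hζ1 : ‖ζ‖ = 1 := by simp [hζ]
  have hζ0 : ζ ≠ 0 := norm_ne_zero_iff.1 (by simp [hζ1])
  set c : E := (ζ * I)⁻¹ • deriv (fun θ : ℝ => G (circleMap 0 1 θ)) θ₀ with hc
  set H : ℂ → E := fun z => G z - G ζ - (z - ζ) • c with hHdef
  have hHd : HasDerivAt (fun θ : ℝ => H (circleMap 0 1 θ)) 0 θ₀ := by
    have h1 := (hθ.hasDerivAt.sub_const (G ζ)).sub
      (((hasDerivAt_circleMap 0 1 θ₀).sub_const ζ).smul_const c)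
    refine h1.congr_deriv ?_
    rw [hc, smul_smul, ← hζ, mul_inv_cancel₀ (mul_ne_zero hζ0 I_ne_zero), one_smul, sub_self]
  have hHK : ∀ z, ‖H z‖ ≤ (K + ‖c‖) * ‖z - ζ‖ := by
    intro z
    calc ‖H z‖ ≤ ‖G z - G ζ‖ + ‖(z - ζ) • c‖ := norm_sub_le _ _
      _ ≤ K * ‖z - ζ‖ + ‖z - ζ‖ * ‖c‖ := by
        rw [norm_smul]
        gcongr
        exact hG.norm_sub_le _ _
      _ = _ := by ring
  have hHdiff : ∀ z ∈ ball (0 : ℂ) 1, HasDerivAt H (f z - c) z := by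
    intro z hz
    have := ((hd z hz).sub_const (G ζ)).sub (((hasDerivAt_id z).sub_const ζ).smul_const c)
    exact this.congr_deriv (by rw [one_smul])
  have hHcl : DiffContOnCl ℂ H (ball 0 1) :=
    ⟨fun z hz => (hHdiff z hz).differentiableAt.differentiableWithinAt,
      Continuous.continuousOn (by have := hG.continuous; fun_prop)⟩
  refine ⟨c, Metric.tendsto_nhds.2 fun ε hε => ?_⟩
  obtain ⟨C, hC, hle⟩ := exists_norm_le_mul_re_of_hasDerivAt_circleMap hHK hHd
    (ε := ε / 6) (by positivity)
  have hre : ∀ z, ((ε / 6 : ℝ) + C * (1 - (starRingEnd ℂ) ζ * z)).re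
      ≤ ε / 6 + C * ‖z - ζ‖ := by
    intro z
    rw [add_re, re_ofReal_mul, ofReal_re]
    gcongr
    refine (re_le_norm _).trans_eq ?_
    have : 1 - (starRingEnd ℂ) ζ * z = - ((starRingEnd ℂ) ζ * (z - ζ)) := by
      rw [mul_sub, mul_comm _ ζ, Complex.mul_conj, Complex.normSq_eq_norm_sq, hζ1]
      simp
    rw [this, norm_neg, norm_mul, RCLike.norm_conj, hζ1, one_mul]
  have hmain : ∀ z ∈ closedBall (0 : ℂ) 1, ‖H z‖ ≤ ‖z - ζ‖ * (ε / 6 + C * ‖z - ζ‖) := by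
    intro z hz
    refine (norm_le_mul_re_of_sphere (P := fun z => (ε / 6 : ℝ) + C * (1 - (starRingEnd ℂ) ζ * z))
      hζ1 hHcl (by fun_prop) hle ?_ hz).trans (mul_le_mul_of_nonneg_left (hre z) (norm_nonneg _))
    intro ξ hξ
    rw [add_re, re_ofReal_mul, ofReal_re]
    have : ((starRingEnd ℂ) ζ * ξ).re ≤ 1 := by
      refine (re_le_norm _).trans_eq ?_
      rw [norm_mul, RCLike.norm_conj, hζ1, one_mul]
      simpa using hξ
    have h2 : 0 ≤ (1 - (starRingEnd ℂ) ζ * ξ).re := by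
      rw [sub_re, one_re]; linarith
    positivity
  have hev : ∀ᶠ r : ℝ in 𝓝[<] 1, 3 * (ε / 6 + C * (3 * ((1 - r) / 2))) < ε := by
    have hlim : 3 * (ε / 6 + C * (3 * ((1 - 1) / 2))) < ε := by linarith
    refine Tendsto.eventually_lt_const hlim ?_
    exact (Continuous.tendsto (by fun_prop) 1).mono_left nhdsWithin_le_nhds
  filter_upwards [hev, Ioo_mem_nhdsLT (zero_lt_one (α := ℝ))] with r hr ⟨hr0, hr1⟩
  refine lt_of_le_of_lt ?_ hr
  have ht : 0 < (1 - r) / 2 := by linarith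
  have hnorm : ‖(r * ζ : ℂ)‖ = r := by simp [hζ1, abs_of_pos hr0]
  have hsub : closedBall ((r : ℂ) * ζ) ((1 - r) / 2) ⊆ ball 0 1 := by
    refine closedBall_subset_ball' ?_
    rw [dist_zero_right, hnorm]
    linarith
  have hmem : (r * ζ : ℂ) ∈ ball (0 : ℂ) 1 := hsub (mem_closedBall_self ht.le)
  rw [dist_eq_norm, ← (hHdiff _ hmem).deriv]
  refine (norm_deriv_le_of_forall_mem_sphere_norm_le ht
    (C := 3 * ((1 - r) / 2) * (ε / 6 + C * (3 * ((1 - r) / 2)))) ?_ ?_).trans_eq (by field_simp)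
  · refine (hHcl.differentiableOn.mono ?_).diffContOnCl
    rw [closure_ball _ ht.ne']
    exact hsub
  · intro w hw
    have h3 : ‖w - ζ‖ ≤ 3 * ((1 - r) / 2) := by
      calc ‖w - ζ‖ ≤ ‖w - r * ζ‖ + ‖r * ζ - ζ‖ := norm_sub_le_norm_sub_add_norm_sub _ _ _
        _ = (1 - r) / 2 + (1 - r) := by
          rw [mem_sphere_iff_norm.1 hw, ← sub_one_mul, norm_mul, hζ1, mul_one, ← ofReal_one,
            ← ofReal_sub, norm_real, Real.norm_eq_abs, abs_sub_comm, abs_of_pos (by linarith)]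
        _ = _ := by ring
    refine (hmain w (ball_subset_closedBall (hsub (sphere_subset_closedBall hw)))).trans ?_
    gcongr

/-- **Fatou's theorem** on the existence of radial limits of bounded holomorphic maps. -/
theorem ae_exists_tendsto_radial [FiniteDimensional ℂ E] {f : ℂ → E} {M : ℝ}
    (hf : DifferentiableOn ℂ f (ball 0 1)) (hM : ∀ z ∈ ball (0 : ℂ) 1, ‖f z‖ ≤ M) :
    ∀ᵐ θ : ℝ, ∃ l, Tendsto (fun r : ℝ => f (r * circleMap 0 1 θ)) (𝓝[<] 1) (𝓝 l) := by
  have : CompleteSpace E := FiniteDimensional.complete ℂ E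
  obtain ⟨G₀, hG₀⟩ := hf.isExactOn_ball
  have hL : LipschitzOnWith M.toNNReal G₀ (ball 0 1) := by
    refine (convex_ball (0 : ℂ) 1).lipschitzOnWith_of_nnnorm_hasDerivWithin_le
      (fun z hz => (hG₀ z hz).hasDerivWithinAt) fun z hz => ?_
    rw [← NNReal.coe_le_coe, coe_nnnorm]
    exact (hM z hz).trans (Real.le_coe_toNNReal M)
  obtain ⟨G, hG, hGG⟩ := hL.extend_finite_dimension
  have hGd : ∀ z ∈ ball (0 : ℂ) 1, HasDerivAt G (f z) z := fun z hz =>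
    (hG₀ z hz).congr_of_eventuallyEq
      (hGG.symm.eventuallyEq_of_mem (isOpen_ball.mem_nhds hz))
  have hcomp := hG.comp (lipschitzWith_circleMap 0 1)
  filter_upwards [hcomp.ae_differentiableAt_real] with θ hθ
  exact exists_tendsto_radial_of_differentiableAt hG hGd hθ

end Fatou

theorem isProbabilityMeasure_thetaM : IsProbabilityMeasure thetaM := by
  refine ⟨?_⟩
  simp only [thetaM, Measure.smul_apply, Measure.restrict_apply_univ, Real.volume_Ico, sub_zero,
    smul_eq_mul]
  rw [← ENNReal.ofReal_mul (by positivity), inv_mul_cancel₀ (by positivity), ENNReal.ofReal_one]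

theorem thetaM_absolutelyContinuous : thetaM ≪ volume :=
  (Measure.smul_absolutelyContinuous).trans Measure.absolutelyContinuous_restrict

theorem integral_circleMap_thetaM {F : Type*} [NormedAddCommGroup F] [NormedSpace ℝ F]
    (w : ℂ → F) (c : ℂ) (r : ℝ) :
    ∫ θ, w (circleMap c r θ) ∂thetaM = Real.circleAverage w c r := by
  rw [thetaM, integral_smul_measure, Real.circleAverage_def,
    intervalIntegral.integral_of_le (by positivity), ENNReal.toReal_ofReal (by positivity),
    Measure.restrict_congr_set Ico_ae_eq_Ioc]

/-- The function `w` on the unit disk has the radial limits `l` at almost every boundary point. -/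
def HasRadialLimits {F : Type*} [TopologicalSpace F] (w : ℂ → F) (l : ℝ → F) : Prop :=
  ∀ᵐ θ ∂thetaM, Tendsto (fun r : ℝ => w (circleMap 0 r θ)) (𝓝[<] 1) (𝓝 (l θ))

theorem circleMap_zero_mem_unitBall {r : ℝ} (h0 : 0 ≤ r) (h1 : r < 1) (θ : ℝ) :
    circleMap 0 r θ ∈ ball (0 : ℂ) 1 := by
  simp [abs_of_nonneg h0, h1]

theorem eventually_circleMap_mem_unitBall (θ : ℝ) :
    ∀ᶠ r : ℝ in 𝓝[<] 1, circleMap 0 r θ ∈ ball (0 : ℂ) 1 := by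
  filter_upwards [Ioo_mem_nhdsLT (zero_lt_one (α := ℝ))] with r hr
  exact circleMap_zero_mem_unitBall hr.1.le hr.2 θ

theorem tendsto_circleMap_radial (θ : ℝ) :
    Tendsto (fun r : ℝ => circleMap 0 r θ) (𝓝[<] 1) (𝓝 (circleMap 0 1 θ)) := by
  refine Tendsto.mono_left (Continuous.tendsto ?_ 1) nhdsWithin_le_nhds
  unfold circleMap
  fun_prop

namespace HasRadialLimits

variable {F : Type*} [NormedAddCommGroup F] {w : ℂ → F} {l : ℝ → F} {C : ℝ}

theorem aestronglyMeasurable (hl : HasRadialLimits w l) (hw : ContinuousOn w (ball 0 1)) :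
    AEStronglyMeasurable l thetaM := by
  obtain ⟨u, -, hu, hlim⟩ := exists_seq_strictMono_tendsto' (zero_lt_one (α := ℝ))
  refine aestronglyMeasurable_of_tendsto_ae atTop
    (f := fun n θ => w (circleMap 0 (u n) θ)) (fun n => ?_) ?_
  · exact (hw.comp_continuous (continuous_circleMap 0 (u n)) fun θ =>
      circleMap_zero_mem_unitBall (hu n).1.le (hu n).2 θ).aestronglyMeasurable
  · filter_upwards [hl] with θ hθ
    exact hθ.comp (tendsto_nhdsWithin_iff.2 ⟨hlim, Eventually.of_forall fun n => (hu n).2⟩)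

theorem ae_norm_le (hl : HasRadialLimits w l) (hC : ∀ z ∈ ball (0 : ℂ) 1, ‖w z‖ ≤ C) :
    ∀ᵐ θ ∂thetaM, ‖l θ‖ ≤ C := by
  filter_upwards [hl] with θ hθ
  exact le_of_tendsto hθ.norm ((eventually_circleMap_mem_unitBall θ).mono fun r hr => hC _ hr)

theorem integrable (hl : HasRadialLimits w l) (hw : ContinuousOn w (ball 0 1))
    (hC : ∀ z ∈ ball (0 : ℂ) 1, ‖w z‖ ≤ C) : Integrable l thetaM :=
  have := isProbabilityMeasure_thetaM
  Integrable.of_bound (hl.aestronglyMeasurable hw) C (hl.ae_norm_le hC)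

theorem tendsto_circleAverage [NormedSpace ℝ F] (hl : HasRadialLimits w l)
    (hw : ContinuousOn w (ball 0 1)) (hC : ∀ z ∈ ball (0 : ℂ) 1, ‖w z‖ ≤ C) :
    Tendsto (fun r => Real.circleAverage w 0 r) (𝓝[<] 1) (𝓝 (∫ θ, l θ ∂thetaM)) := by
  have := isProbabilityMeasure_thetaM
  simp only [← integral_circleMap_thetaM]
  refine tendsto_integral_filter_of_dominated_convergence (fun _ => C) ?_ ?_
    (integrable_const C) hl
  · filter_upwards [Ioo_mem_nhdsLT (zero_lt_one (α := ℝ))] with r hr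
    exact (hw.comp_continuous (continuous_circleMap 0 r) fun θ =>
      circleMap_zero_mem_unitBall hr.1.le hr.2 θ).aestronglyMeasurable
  · filter_upwards [Ioo_mem_nhdsLT (zero_lt_one (α := ℝ))] with r hr
    exact Eventually.of_forall fun θ => hC _ (circleMap_zero_mem_unitBall hr.1.le hr.2 θ)

theorem comp_continuousOn {G : Type*} [TopologicalSpace G] {p : ℂ → ℂ} {pb : ℝ → ℂ}
    (h : HasRadialLimits p pb) (hp : MapsTo p (ball 0 1) (ball 0 1)) {ψ : ℂ → G}
    (hψ : ContinuousOn ψ (closedBall 0 1)) :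
    HasRadialLimits (fun z => ψ (p z)) (fun θ => ψ (pb θ)) := by
  filter_upwards [h, h.ae_norm_le fun z hz => (mem_ball_zero_iff.1 (hp hz)).le] with θ hθ hb
  refine (hψ _ (mem_closedBall_zero_iff.2 hb)).tendsto.comp (tendsto_nhdsWithin_iff.2 ⟨hθ, ?_⟩)
  exact (eventually_circleMap_mem_unitBall θ).mono fun r hr => ball_subset_closedBall (hp hr)

end HasRadialLimits

theorem hasRadialLimits_id : HasRadialLimits id (circleMap 0 1) :=
  Eventually.of_forall tendsto_circleMap_radial

theorem exists_hasRadialLimits {E : Type*} [NormedAddCommGroup E] [NormedSpace ℂ E]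
    [FiniteDimensional ℂ E] {f : ℂ → E} {M : ℝ} (hf : DifferentiableOn ℂ f (ball 0 1))
    (hM : ∀ z ∈ ball (0 : ℂ) 1, ‖f z‖ ≤ M) : ∃ l, HasRadialLimits f l := by
  have h := thetaM_absolutelyContinuous.ae_le (ae_exists_tendsto_radial hf hM)
  classical
  refine ⟨fun θ => if h : ∃ l, Tendsto (fun r : ℝ => f (r * circleMap 0 1 θ)) (𝓝[<] 1) (𝓝 l)
    then h.choose else 0, ?_⟩
  filter_upwards [h] with θ hθ
  rw [dif_pos hθ]
  refine hθ.choose_spec.congr fun r => ?_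
  simp [circleMap]

theorem hasRadialLimits_bval {n : ℕ} {f : ℂ → En n} {M : ℝ} (hf : DifferentiableOn ℂ f (ball 0 1))
    (hM : ∀ z ∈ ball (0 : ℂ) 1, ‖f z‖ ≤ M) :
    HasRadialLimits f fun θ => bval f (circleMap 0 1 θ) := by
  have h := thetaM_absolutelyContinuous.ae_le (ae_exists_tendsto_radial hf hM)
  filter_upwards [h] with θ hθ
  rw [bval, dif_pos hθ]
  refine hθ.choose_spec.congr fun r => ?_
  simp [circleMap]

theorem integral_bmeas {n : ℕ} {f : ℂ → En n} {M : ℝ} (hf : DifferentiableOn ℂ f (ball 0 1))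
    (hM : ∀ z ∈ ball (0 : ℂ) 1, ‖f z‖ ≤ M) {φ : En n → ℝ} (hφ : Continuous φ) :
    ∫ x, φ x ∂(bmeas f) = ∫ θ, φ (bval f (circleMap 0 1 θ)) ∂thetaM :=
  integral_map ((hasRadialLimits_bval hf hM).aestronglyMeasurable hf.continuousOn).aemeasurable
    hφ.aestronglyMeasurable

theorem circleAverage_norm_comp_le {E : Type*} [NormedAddCommGroup E] [NormedSpace ℂ E]
    [CompleteSpace E] {h : ℂ → E} {p : ℂ → ℂ} {r : ℝ} (hr : 0 < r) (hr1 : r < 1)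
    (hh : DifferentiableOn ℂ h (ball 0 1)) (hp : DifferentiableOn ℂ p (ball 0 1))
    (hpn : ∀ z ∈ ball (0 : ℂ) 1, ‖p z‖ ≤ ‖z‖) (hp0 : p 0 = 0) :
    Real.circleAverage (fun z => ‖h (p z)‖) 0 r ≤ Real.circleAverage (fun z => ‖h z‖) 0 r := by
  have hsub : closedBall (0 : ℂ) r ⊆ ball 0 1 := closedBall_subset_ball hr1
  have hmaps : MapsTo p (ball 0 1) (ball 0 1) := fun z hz =>
    mem_ball_zero_iff.2 ((hpn z hz).trans_lt (mem_ball_zero_iff.1 hz))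
  have hci : CircleIntegrable (fun z => ‖h z‖) 0 r :=
    (hh.continuousOn.norm).circleIntegrable_of_closedBall_subset hr.le hsub
  have hcip : CircleIntegrable (fun z => ‖h (p z)‖) 0 r :=
    ((hh.continuousOn.comp hp.continuousOn hmaps).norm).circleIntegrable_of_closedBall_subset
      hr.le hsub
  refine le_of_forall_pos_le_add fun κ hκ => ?_
  obtain ⟨P, hP, hPs⟩ := exists_entire_re_near (φ := fun z => ‖h z‖ + κ / 2) (c := 0) hr
    ((hh.continuousOn.norm.mono (sphere_subset_closedBall.trans hsub)).add continuousOn_const)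
    (half_pos hκ)
  have hle : ∀ z ∈ closedBall (0 : ℂ) r, ‖h z‖ ≤ (P z).re := by
    refine norm_le_re_entire_of_sphere hr ?_ hP fun z hz => ?_
    · exact (hh.mono (by rwa [closure_ball _ hr.ne'])).diffContOnCl
    · linarith [(abs_lt.1 (hPs z hz)).1]
  have hPp : DifferentiableOn ℂ (fun z => P (p z)) (ball 0 1) := hP.comp_differentiableOn hp
  have habs : |r| = r := abs_of_pos hr
  calc Real.circleAverage (fun z => ‖h (p z)‖) 0 r
      ≤ Real.circleAverage (fun z => (P (p z)).re) 0 r := by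
        refine Real.circleAverage_mono hcip ?_ fun z hz => ?_
        · exact (continuous_re.comp_continuousOn
            hPp.continuousOn).circleIntegrable_of_closedBall_subset hr.le hsub
        · rw [habs] at hz
          have hz' := sphere_subset_closedBall hz
          exact hle _ (mem_closedBall_zero_iff.2
            ((hpn z (hsub hz')).trans (mem_closedBall_zero_iff.1 hz')))
    _ = (P 0).re := by
        rw [circleAverage_re_of_differentiableOn hPp hr hr1, hp0]
    _ = Real.circleAverage (fun z => (P z).re) 0 r := (circleAverage_re_entire hP 0 r).symm
    _ ≤ Real.circleAverage (fun z => ‖h z‖ + κ) 0 r := by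
        refine Real.circleAverage_mono ?_ ?_ fun z hz => ?_
        · exact ((continuous_re.comp hP.continuous).continuousOn
            (s := closedBall 0 r)).circleIntegrable_of_closedBall_subset hr.le Subset.rfl
        · exact hci.add (circleIntegrable_const _ _ _)
        · rw [habs] at hz
          linarith [(abs_lt.1 (hPs z hz)).2]
    _ = _ := by
        rw [Real.circleAverage_fun_add hci (circleIntegrable_const _ _ _),
          Real.circleAverage_const]

namespace IsDiskCover

variable {A : Set ℂ} {p : ℂ → ℂ} {pb : ℝ → ℂ} {u : ℂ → ℝ}

theorem radial_limit_notMem (hp : IsDiskCover A p) {θ : ℝ} {x : ℂ}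
    (hx : Tendsto (fun r : ℝ => p (circleMap 0 r θ)) (𝓝[<] 1) (𝓝 x)) : x ∉ ball (0 : ℂ) 1 \ A := by
  intro hxU
  obtain ⟨ρ, hρ, hN⟩ := Metric.isOpen_iff.1 hp.isOpen_diff x hxU
  obtain ⟨r₁, hr₁, hr₁'⟩ := mem_nhdsLT_iff_exists_Ioo_subset.1 (hx (ball_mem_nhds x hρ))
  obtain ⟨r₀, hr₀, hr₀1⟩ := exists_between (max_lt hr₁ (zero_lt_one (α := ℝ)))
  rw [max_lt_iff] at hr₀
  have hmem : ∀ r ∈ Ico r₀ 1, circleMap 0 r θ ∈ ball (0 : ℂ) 1 := fun r hr =>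
    circleMap_zero_mem_unitBall (hr₀.2.le.trans hr.1) hr.2 θ
  have hpN : ∀ r ∈ Ico r₀ 1, p (circleMap 0 r θ) ∈ ball x ρ := fun r hr =>
    hr₁' ⟨hr₀.1.trans_le hr.1, hr.2⟩
  have hr₀m : r₀ ∈ Ico r₀ 1 := left_mem_Ico.2 hr₀1
  obtain ⟨q, hq0, hqd, hqm, hpq⟩ := hp.exists_branch isOpen_ball (convex_ball x ρ) hN
    (hmem r₀ hr₀m) (hpN r₀ hr₀m)
  have hcont : Continuous fun r : ℝ => circleMap 0 r θ := by
    unfold circleMap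
    fun_prop
  have heq : EqOn (fun z => q (p z)) id ((fun r : ℝ => circleMap 0 r θ) '' Ico r₀ 1) := by
    refine AnalyticOnNhd.eqOn_of_preconnected_of_eventuallyEq (𝕜 := ℂ) ?_ analyticOnNhd_id
      (isPreconnected_Ico.image _ hcont.continuousOn) (mem_image_of_mem _ hr₀m)
      (hp.eventually_branch_comp isOpen_ball hqd hpq (hmem r₀ hr₀m) (hpN r₀ hr₀m) hq0)
    rintro _ ⟨r, hr, rfl⟩
    exact AnalyticAt.fun_comp (hqd.analyticAt (isOpen_ball.mem_nhds (hpN r hr)))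
      (hp.holo.analyticAt (isOpen_ball.mem_nhds (hmem r hr)))
  have hlim : Tendsto (fun r : ℝ => q (p (circleMap 0 r θ))) (𝓝[<] 1) (𝓝 (q x)) :=
    ((hqd.continuousOn.continuousAt (ball_mem_nhds x hρ)).tendsto).comp hx
  have hq1 : q x = circleMap 0 1 θ := by
    refine tendsto_nhds_unique hlim ((tendsto_circleMap_radial θ).congr' ?_)
    filter_upwards [Ico_mem_nhdsLT hr₀1] with r hr
    exact (heq (mem_image_of_mem _ hr)).symm
  have := hqm (mem_ball_self hρ)
  rw [hq1] at this
  simp at this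

theorem integral_barrier_le (hp : IsDiskCover A p) (hpb : HasRadialLimits p pb)
    (hu : IsBarrier A u) :
    Integrable (fun θ => u (pb θ)) thetaM ∧ ∫ θ, u (pb θ) ∂thetaM ≤ u 0 := by
  obtain ⟨C, hC⟩ := (isCompact_closedBall (0 : ℂ) 1).exists_bound_of_continuousOn hu.cont
  have hrad := hpb.comp_continuousOn hp.mapsTo_ball hu.cont
  have hcont : ContinuousOn (fun z => u (p z)) (ball 0 1) :=
    (hu.cont.mono ball_subset_closedBall).comp hp.holo.continuousOn hp.mapsTo_ball
  have hbd : ∀ z ∈ ball (0 : ℂ) 1, ‖u (p z)‖ ≤ C := fun z hz =>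
    hC _ (ball_subset_closedBall (hp.mapsTo_ball hz))
  refine ⟨hrad.integrable hcont hbd, le_of_tendsto (hrad.tendsto_circleAverage hcont hbd) ?_⟩
  filter_upwards [Ioo_mem_nhdsLT (zero_lt_one (α := ℝ))] with r hr
  have := hp.circleAverage_comp_le hu.superharm (hu.cont.mono ball_subset_closedBall) hr.1
    (closedBall_subset_ball (x := (0 : ℂ)) hr.2)
  rwa [hp.zero] at this

theorem ae_one_le_barrier (hp : IsDiskCover A p) (hpb : HasRadialLimits p pb)
    (hu : IsBarrier A u) :
    ∀ᵐ θ ∂thetaM, pb θ ∈ closedBall (0 : ℂ) 1 ∧ (pb θ ∉ sphere (0 : ℂ) 1 → 1 ≤ u (pb θ)) := by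
  filter_upwards [hpb, hpb.ae_norm_le fun z hz => (mem_ball_zero_iff.1 (hp.mapsTo_ball hz)).le]
    with θ hθ hb
  refine ⟨mem_closedBall_zero_iff.2 hb, fun hs => hu.one_le _ ?_⟩
  by_contra hA
  refine hp.radial_limit_notMem hθ ⟨mem_ball_zero_iff.2 (hb.lt_of_ne fun h => hs ?_), hA⟩
  exact mem_sphere_zero_iff_norm.2 h

theorem abs_integral_sub_le (hp : IsDiskCover A p) (hpb : HasRadialLimits p pb)
    (hu : IsBarrier A u) {ψ : ℂ → ℝ} {M : ℝ} (hψ : ContinuousOn ψ (closedBall 0 1))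
    (hM : ∀ z ∈ closedBall (0 : ℂ) 1, |ψ z| ≤ M) :
    |∫ θ, ψ (pb θ) ∂thetaM - ∫ θ, ψ (circleMap 0 1 θ) ∂thetaM| ≤ 2 * M * u 0 := by
  have := isProbabilityMeasure_thetaM
  obtain ⟨hui, hule⟩ := hp.integral_barrier_le hpb hu
  have hcomp : ∀ {χ : ℂ → ℝ}, ContinuousOn χ (closedBall 0 1) →
      ContinuousOn (fun z => χ (p z)) (ball 0 1) := fun h =>
    (h.mono ball_subset_closedBall).comp hp.holo.continuousOn hp.mapsTo_ball
  have hintg : ∀ {χ : ℂ → ℝ} {N : ℝ}, ContinuousOn χ (closedBall 0 1) →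
      (∀ z ∈ closedBall (0 : ℂ) 1, |χ z| ≤ N) → Integrable (fun θ => χ (pb θ)) thetaM :=
    fun h hN => (hpb.comp_continuousOn hp.mapsTo_ball h).integrable (hcomp h) fun z hz =>
      hN _ (ball_subset_closedBall (hp.mapsTo_ball hz))
  have hintg' : ∀ {χ : ℂ → ℝ} {N : ℝ}, ContinuousOn χ (closedBall 0 1) →
      (∀ z ∈ closedBall (0 : ℂ) 1, |χ z| ≤ N) →
      Integrable (fun θ => χ (circleMap 0 1 θ)) thetaM := fun h hN => by
    have hm : ∀ θ, circleMap 0 1 θ ∈ closedBall (0 : ℂ) 1 := fun θ => by simp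
    exact Integrable.of_bound
      (h.comp_continuous (continuous_circleMap 0 1) hm).aestronglyMeasurable _
      (Eventually.of_forall fun θ => hN _ (hm θ))
  have hM0 : 0 ≤ M := (abs_nonneg _).trans (hM 0 (by simp))
  have hu0 : 0 ≤ u 0 := hu.nonneg 0 (by simp)
  have key : ∀ ε > 0, |∫ θ, ψ (pb θ) ∂thetaM - ∫ θ, ψ (circleMap 0 1 θ) ∂thetaM|
      ≤ 2 * M * u 0 + ε * (2 + u 0) := by
    intro ε hε
    obtain ⟨P, hP, hPs⟩ := exists_entire_re_near one_pos (hψ.mono sphere_subset_closedBall) hε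
    have hPc : ContinuousOn (fun z => (P z).re) (closedBall 0 1) :=
      (continuous_re.comp hP.continuous).continuousOn
    have hPb : ∀ z ∈ closedBall (0 : ℂ) 1, |(P z).re| ≤ M + ε := by
      intro z hz
      have hs : ∀ w ∈ sphere (0 : ℂ) 1, |(P w).re| ≤ M + ε := fun w hw => by
        have h1 := hPs w hw
        have h2 := hM w (sphere_subset_closedBall hw)
        rw [abs_lt] at h1
        rw [abs_le] at h2 ⊢
        constructor <;> linarith [h1.1, h1.2, h2.1, h2.2]
      have h1 := le_re_entire_of_sphere hP one_pos (m := -(M + ε))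
        (fun w hw => (abs_le.1 (hs w hw)).1) z hz
      have h2 := le_re_entire_of_sphere hP.neg one_pos (m := -(M + ε))
        (fun w hw => by simpa using (abs_le.1 (hs w hw)).2) z hz
      simp only [Pi.neg_apply, neg_re, neg_le_neg_iff] at h2
      exact abs_le.2 ⟨h1, h2⟩
    have hPint : ∫ θ, (P (pb θ)).re ∂thetaM = (P 0).re := by
      refine tendsto_nhds_unique ((hpb.comp_continuousOn hp.mapsTo_ball hPc).tendsto_circleAverage
        (hcomp hPc) fun z hz => hPb _ (ball_subset_closedBall (hp.mapsTo_ball hz)))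
        (tendsto_const_nhds.congr' ?_)
      filter_upwards [Ioo_mem_nhdsLT (zero_lt_one (α := ℝ))] with r hr
      rw [circleAverage_re_of_differentiableOn (P := fun z => P (p z))
        (hP.comp_differentiableOn hp.holo) hr.1 hr.2, hp.zero]
    have hPint' : ∫ θ, (P (circleMap 0 1 θ)).re ∂thetaM = (P 0).re := by
      rw [integral_circleMap_thetaM (fun z => (P z).re), circleAverage_re_entire hP]
    have h1 : |∫ θ, ψ (pb θ) ∂thetaM - (P 0).re| ≤ ε + (2 * M + ε) * u 0 := by
      rw [← hPint, ← integral_sub (hintg hψ hM) (hintg hPc hPb), ← Real.norm_eq_abs]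
      have hi : Integrable (fun θ => ε + (2 * M + ε) * u (pb θ)) thetaM :=
        (integrable_const ε).add (hui.const_mul _)
      refine (norm_integral_le_of_norm_le hi ?_).trans ?_
      · filter_upwards [hp.ae_one_le_barrier hpb hu] with θ ⟨hc, hθ⟩
        have hnn := hu.nonneg _ hc
        rw [Real.norm_eq_abs]
        by_cases hs : pb θ ∈ sphere (0 : ℂ) 1
        · have := hPs _ hs
          rw [abs_sub_comm] at this
          have h2 : 0 ≤ (2 * M + ε) * u (pb θ) := by positivity
          linarith
        · have h2 := hθ hs
          have h3 := abs_sub (ψ (pb θ)) (P (pb θ)).re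
          have h4 : 2 * M + ε ≤ (2 * M + ε) * u (pb θ) :=
            le_mul_of_one_le_right (by positivity) h2
          linarith [hM _ hc, hPb _ hc]
      · rw [integral_add (integrable_const ε) (hui.const_mul _), integral_const_mul]
        simp only [integral_const, probReal_univ, one_smul]
        gcongr
    have h2 : |∫ θ, ψ (circleMap 0 1 θ) ∂thetaM - (P 0).re| ≤ ε := by
      rw [← hPint', ← integral_sub (hintg' hψ hM) (hintg' hPc hPb), ← Real.norm_eq_abs]
      refine (norm_integral_le_of_norm_le_const (C := ε) (Eventually.of_forall fun θ => ?_)).trans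
        (by simp)
      rw [Real.norm_eq_abs, abs_sub_comm]
      exact (hPs _ (by simp)).le
    rw [abs_le] at h1 h2 ⊢
    constructor <;> linarith [h1.1, h1.2, h2.1, h2.2]
  have ht : Tendsto (fun ε : ℝ => 2 * M * u 0 + ε * (2 + u 0)) (𝓝[>] 0)
      (𝓝 (2 * M * u 0 + 0 * (2 + u 0))) :=
    (Continuous.tendsto (by fun_prop) 0).mono_left nhdsWithin_le_nhds
  rw [zero_mul, add_zero] at ht
  exact ge_of_tendsto ht (eventually_mem_nhdsWithin.mono key)

end IsDiskCover

theorem exists_abs_sub_le_add_mul_norm {X : Type*} [NormedAddCommGroup X] {φ : X → ℝ} {S : Set X}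
    (hS : IsCompact S) (hφ : ContinuousOn φ S) {η : ℝ} (hη : 0 < η) :
    ∃ K, 0 ≤ K ∧ ∀ x ∈ S, ∀ y ∈ S, |φ x - φ y| ≤ η + K * ‖x - y‖ := by
  obtain ⟨δ, hδ, hd⟩ := Metric.uniformContinuousOn_iff.1
    (hS.uniformContinuousOn_of_continuous hφ) η hη
  obtain ⟨M, hM⟩ := hS.exists_bound_of_continuousOn hφ
  refine ⟨2 * |M| / δ, by positivity, fun x hx y hy => ?_⟩
  have hnn : 0 ≤ 2 * |M| / δ * ‖x - y‖ := by positivity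
  rcases lt_or_ge (dist x y) δ with h | h
  · have := hd x hx y hy h
    rw [Real.dist_eq] at this
    linarith
  · rw [dist_eq_norm] at h
    have h1 : 1 ≤ ‖x - y‖ / δ := (one_le_div hδ).2 h
    calc |φ x - φ y| ≤ |φ x| + |φ y| := abs_sub _ _
      _ ≤ 2 * |M| * 1 := by
        have h2 := (hM x hx).trans (le_abs_self M)
        have h3 := (hM y hy).trans (le_abs_self M)
        rw [Real.norm_eq_abs] at h2 h3
        linarith
      _ ≤ 2 * |M| * (‖x - y‖ / δ) := by gcongr
      _ = 2 * |M| / δ * ‖x - y‖ := by ring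
      _ ≤ _ := by linarith

theorem dilate_mem_unitBall {t : ℝ} (h0 : 0 ≤ t) (h1 : t < 1) {z : ℂ}
    (hz : z ∈ closedBall (0 : ℂ) 1) : (t : ℂ) * z ∈ ball (0 : ℂ) 1 := by
  rw [mem_closedBall_zero_iff] at hz
  rw [mem_ball_zero_iff, norm_mul, norm_real, Real.norm_eq_abs, abs_of_nonneg h0]
  nlinarith

section

variable {E : Type*} [NormedAddCommGroup E] {f : ℂ → E} {C : ℝ} {l : ℝ → E}

theorem tendsto_integral_norm_sub_dilate (hf : ContinuousOn f (ball 0 1))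
    (hC : ∀ z ∈ ball (0 : ℂ) 1, ‖f z‖ ≤ C) (hl : HasRadialLimits f l) :
    Tendsto (fun t : ℝ => ∫ θ, ‖l θ - f (t * circleMap 0 1 θ)‖ ∂thetaM) (𝓝[<] 1) (𝓝 0) := by
  have := isProbabilityMeasure_thetaM
  have h0 : (0 : ℝ) = ∫ _θ : ℝ, (0 : ℝ) ∂thetaM := by simp
  rw [h0]
  have hmem : ∀ t ∈ Ioo (0 : ℝ) 1, ∀ θ, (t : ℂ) * circleMap 0 1 θ ∈ ball (0 : ℂ) 1 :=
    fun t ht θ => dilate_mem_unitBall ht.1.le ht.2 (by simp)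
  refine tendsto_integral_filter_of_dominated_convergence (fun _ => C + C) ?_ ?_
    (integrable_const _) ?_
  · filter_upwards [Ioo_mem_nhdsLT (zero_lt_one (α := ℝ))] with t ht
    exact ((hl.aestronglyMeasurable hf).sub (hf.comp_continuous (by fun_prop)
      (hmem t ht)).aestronglyMeasurable).norm
  · filter_upwards [Ioo_mem_nhdsLT (zero_lt_one (α := ℝ))] with t ht
    filter_upwards [hl.ae_norm_le hC] with θ hθ
    rw [norm_norm]
    exact (norm_sub_le _ _).trans (add_le_add hθ (hC _ (hmem t ht θ)))
  · filter_upwards [hl] with θ hθ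
    have h1 : Tendsto (fun t : ℝ => ‖l θ - f (circleMap 0 t θ)‖) (𝓝[<] 1) (𝓝 ‖l θ - l θ‖) :=
      (tendsto_const_nhds.sub hθ).norm
    rw [sub_self, norm_zero] at h1
    refine h1.congr fun t => ?_
    simp [circleMap]

namespace IsDiskCover

variable [NormedSpace ℂ E] {A : Set ℂ} {p : ℂ → ℂ} {pb : ℝ → ℂ} {u : ℂ → ℝ} {F : ℝ → E}

theorem integral_norm_sub_dilate_le [CompleteSpace E] (hp : IsDiskCover A p)
    (hpb : HasRadialLimits p pb) (hf : DifferentiableOn ℂ f (ball 0 1))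
    (hC : ∀ z ∈ ball (0 : ℂ) 1, ‖f z‖ ≤ C) (hl : HasRadialLimits f l)
    (hF : HasRadialLimits (f ∘ p) F) {t : ℝ} (ht : t ∈ Ioo (0 : ℝ) 1) :
    ∫ θ, ‖F θ - f (t * pb θ)‖ ∂thetaM ≤ ∫ θ, ‖l θ - f (t * circleMap 0 1 θ)‖ ∂thetaM := by
  have hmem : ∀ z ∈ closedBall (0 : ℂ) 1, (t : ℂ) * z ∈ ball (0 : ℂ) 1 :=
    fun z hz => dilate_mem_unitBall ht.1.le ht.2 hz
  have hft : ContinuousOn (fun z => f (t * z)) (closedBall 0 1) :=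
    hf.continuousOn.comp (by fun_prop) hmem
  have hftd : DifferentiableOn ℂ (fun z => f z - f (t * z)) (ball 0 1) :=
    hf.sub (hf.comp (by fun_prop) fun z hz => hmem z (ball_subset_closedBall hz))
  have hb : ∀ z ∈ ball (0 : ℂ) 1, ‖‖f z - f (t * z)‖‖ ≤ C + C := fun z hz => by
    rw [norm_norm]
    exact (norm_sub_le _ _).trans
      (add_le_add (hC z hz) (hC _ (hmem z (ball_subset_closedBall hz))))
  have h1 : HasRadialLimits (fun z => ‖f z - f (t * z)‖)
      (fun θ => ‖l θ - f (t * circleMap 0 1 θ)‖) := by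
    filter_upwards [hl, hasRadialLimits_id.comp_continuousOn (mapsTo_id _) hft] with θ h h'
    exact (h.sub h').norm
  have h2 : HasRadialLimits (fun z => ‖f (p z) - f (t * p z)‖) (fun θ => ‖F θ - f (t * pb θ)‖) := by
    filter_upwards [hF, hpb.comp_continuousOn hp.mapsTo_ball hft] with θ h h'
    exact (h.sub h').norm
  refine le_of_tendsto_of_tendsto (h2.tendsto_circleAverage ?_ fun z hz => hb _ (hp.mapsTo_ball hz))
    (h1.tendsto_circleAverage hftd.continuousOn.norm hb) ?_
  · exact hftd.continuousOn.norm.comp hp.holo.continuousOn hp.mapsTo_ball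
  · filter_upwards [Ioo_mem_nhdsLT (zero_lt_one (α := ℝ))] with r hr
    exact circleAverage_norm_comp_le hr.1 hr.2 hftd hp.holo (fun z hz => hp.norm_le hz) hp.zero

theorem abs_integral_comp_sub_le [FiniteDimensional ℂ E] (hp : IsDiskCover A p)
    (hu : IsBarrier A u) (hf : DifferentiableOn ℂ f (ball 0 1))
    (hC : ∀ z ∈ ball (0 : ℂ) 1, ‖f z‖ ≤ C) (hl : HasRadialLimits f l)
    (hF : HasRadialLimits (f ∘ p) F) {φ : E → ℝ} {M : ℝ} (hφ : Continuous φ)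
    (hM : ∀ x, |φ x| ≤ M) :
    |∫ θ, φ (F θ) ∂thetaM - ∫ θ, φ (l θ) ∂thetaM| ≤ 2 * M * u 0 := by
  have := isProbabilityMeasure_thetaM
  have : CompleteSpace E := FiniteDimensional.complete ℂ E
  have : ProperSpace E := FiniteDimensional.proper ℂ E
  obtain ⟨pb, hpb⟩ := exists_hasRadialLimits hp.holo
    fun z hz => (mem_ball_zero_iff.1 (hp.mapsTo_ball hz)).le
  have hCp : ∀ z ∈ ball (0 : ℂ) 1, ‖(f ∘ p) z‖ ≤ C := fun z hz => hC _ (hp.mapsTo_ball hz)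
  have hpc : ContinuousOn (f ∘ p) (ball 0 1) :=
    hf.continuousOn.comp hp.holo.continuousOn hp.mapsTo_ball
  have hFm := hF.aestronglyMeasurable hpc
  have hlm := hl.aestronglyMeasurable hf.continuousOn
  have hFC := hF.ae_norm_le hCp
  have hlC := hl.ae_norm_le hC
  have hpbC := hpb.ae_norm_le fun z hz => (mem_ball_zero_iff.1 (hp.mapsTo_ball hz)).le
  have hφi : ∀ {v : ℝ → E}, AEStronglyMeasurable v thetaM → Integrable (fun θ => φ (v θ)) thetaM :=
    fun hv => Integrable.of_bound (hφ.comp_aestronglyMeasurable hv) M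
      (Eventually.of_forall fun θ => hM _)
  have hclose : ∀ {v w : ℝ → E} {η K : ℝ}, AEStronglyMeasurable v thetaM →
      AEStronglyMeasurable w thetaM → (∀ᵐ θ ∂thetaM, ‖v θ‖ ≤ C) → (∀ᵐ θ ∂thetaM, ‖w θ‖ ≤ C) →
      (∀ x ∈ closedBall (0 : E) C, ∀ y ∈ closedBall (0 : E) C, |φ x - φ y| ≤ η + K * ‖x - y‖) →
      |∫ θ, φ (v θ) ∂thetaM - ∫ θ, φ (w θ) ∂thetaM| ≤ η + K * ∫ θ, ‖v θ - w θ‖ ∂thetaM := by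
    intro v w η K hv hw hvC hwC h
    have hi : Integrable (fun θ => ‖v θ - w θ‖) thetaM := by
      refine (Integrable.of_bound (hv.sub hw) (C + C) ?_).norm
      filter_upwards [hvC, hwC] with θ h1 h2
      exact (norm_sub_le _ _).trans (add_le_add h1 h2)
    rw [← integral_sub (hφi hv) (hφi hw), ← Real.norm_eq_abs]
    refine (norm_integral_le_of_norm_le ((integrable_const η).add (hi.const_mul K)) ?_).trans ?_
    · filter_upwards [hvC, hwC] with θ h1 h2
      exact h _ (mem_closedBall_zero_iff.2 h1) _ (mem_closedBall_zero_iff.2 h2)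
    · simp only [Pi.add_apply]
      rw [integral_add (integrable_const η) (hi.const_mul _), integral_const_mul]
      simp
  refine le_of_forall_pos_le_add fun η hη => ?_
  obtain ⟨K, hK0, hK⟩ := exists_abs_sub_le_add_mul_norm (isCompact_closedBall (0 : E) C)
    hφ.continuousOn (half_pos hη)
  have ht : Tendsto (fun t : ℝ => 2 * M * u 0 + (η + 2 * K *
      ∫ θ, ‖l θ - f (t * circleMap 0 1 θ)‖ ∂thetaM)) (𝓝[<] 1)
      (𝓝 (2 * M * u 0 + (η + 2 * K * 0))) :=
    (((tendsto_integral_norm_sub_dilate hf.continuousOn hC hl).const_mul _).const_add _).const_add _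
  rw [mul_zero, add_zero] at ht
  refine ge_of_tendsto ht ?_
  filter_upwards [Ioo_mem_nhdsLT (zero_lt_one (α := ℝ))] with t ht
  have hmem : ∀ z ∈ closedBall (0 : ℂ) 1, (t : ℂ) * z ∈ ball (0 : ℂ) 1 :=
    fun z hz => dilate_mem_unitBall ht.1.le ht.2 hz
  have hft : ContinuousOn (fun z => f (t * z)) (closedBall 0 1) :=
    hf.continuousOn.comp (by fun_prop) hmem
  have hcirc : ∀ θ, circleMap 0 1 θ ∈ closedBall (0 : ℂ) 1 := fun θ => by simp
  have h1 := hclose hFm ((hpb.comp_continuousOn hp.mapsTo_ball hft).aestronglyMeasurable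
    ((hft.mono ball_subset_closedBall).comp hp.holo.continuousOn hp.mapsTo_ball)) hFC
    (hpbC.mono fun θ h => hC _ (hmem _ (mem_closedBall_zero_iff.2 h))) hK
  have h2 := hclose hlm (hft.comp_continuous (continuous_circleMap 0 1)
    hcirc).aestronglyMeasurable hlC (Eventually.of_forall fun θ => hC _ (hmem _ (hcirc θ))) hK
  have h3 := hp.abs_integral_sub_le hpb hu (hφ.comp_continuousOn hft) fun z _ => hM _
  have h4 := mul_le_mul_of_nonneg_left (hp.integral_norm_sub_dilate_le hpb hf hC hl hF ht) hK0
  simp only [Function.comp_apply] at h2 h3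
  rw [abs_le] at h1 h2 h3 ⊢
  constructor <;> linarith [h1.1, h1.2, h2.1, h2.2, h3.1, h3.2]

theorem abs_integral_bmeas_comp_sub_le {n : ℕ} (hp : IsDiskCover A p) {f : ℂ → En n}
    (hf : DifferentiableOn ℂ f (ball 0 1)) (hC : ∀ z ∈ ball (0 : ℂ) 1, ‖f z‖ ≤ C)
    (φ : BoundedContinuousFunction (En n) ℝ) :
    |∫ x, φ x ∂(bmeas (f ∘ p)) - ∫ x, φ x ∂(bmeas f)| ≤ 10 * ‖φ‖ * hm 0 A := by
  obtain ⟨d, hd, hd1, hA⟩ := hp.exists_disjoint_ball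
  have hfp : DifferentiableOn ℂ (f ∘ p) (ball 0 1) := hf.comp hp.holo hp.mapsTo_ball
  have hCp : ∀ z ∈ ball (0 : ℂ) 1, ‖(f ∘ p) z‖ ≤ C := fun z hz => hC _ (hp.mapsTo_ball hz)
  rw [integral_bmeas hfp hCp φ.continuous, integral_bmeas hf hC φ.continuous]
  have key : ∀ ε, hm 0 A < ε → _ ≤ 10 * ‖φ‖ * ε := fun ε hε => by
    obtain ⟨v, hv, hv0⟩ := exists_isBarrier_le_of_hm_lt hd hd1 hA hε
    refine (hp.abs_integral_comp_sub_le hv hf hC (hasRadialLimits_bval hf hC)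
      (hasRadialLimits_bval hfp hCp) φ.continuous fun x => φ.norm_coe_le_norm x).trans ?_
    calc 2 * ‖φ‖ * v 0 ≤ 2 * ‖φ‖ * (5 * ε) := by
          gcongr
          exact hv0 0 (mem_ball_self (by positivity))
      _ = 10 * ‖φ‖ * ε := by ring
  have ht : Tendsto (fun ε : ℝ => 10 * ‖φ‖ * ε) (𝓝[>] hm 0 A) (𝓝 (10 * ‖φ‖ * hm 0 A)) :=
    (Continuous.tendsto (by fun_prop) _).mono_left nhdsWithin_le_nhds
  exact ge_of_tendsto ht (eventually_mem_nhdsWithin.mono key)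

theorem preimage_subset_of_comp_notMem (hp : IsDiskCover A p) {X : Type*} {f : ℂ → X} {V : Set X}
    (h : ∀ ζ ∈ ball (0 : ℂ) 1, f (p ζ) ∉ V) : f ⁻¹' V ∩ ball 0 1 ⊆ A := by
  rintro w ⟨hwV, hw⟩
  by_contra hwA
  obtain ⟨z, hz, rfl⟩ := hp.surj ⟨hw, hwA⟩
  exact h z hz hwV

end IsDiskCover

end

theorem isBoundedUnder_ge_hm {ι : Type*} (S : ι → Set ℂ) (F : Filter ι) :
    IsBoundedUnder (· ≥ ·) F fun j => hm 0 (S j) :=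
  isBoundedUnder_of ⟨0, fun _ => hm_nonneg _⟩

theorem isCoboundedUnder_ge_hm {ι : Type*} (S : ι → Set ℂ) (F : Filter ι) [NeBot F] :
    IsCoboundedUnder (· ≥ ·) F fun j => hm 0 (S j) :=
  (isBoundedUnder_of ⟨1, fun _ => hm_le_one _⟩ : IsBoundedUnder (· ≤ ·) F _).isCoboundedUnder_ge

/-- Lemma 7.1: composing a totally perfect sequence with covering maps of the disk minus
small closed sets preserves the cluster set, the center and the limit measure. -/
theorem stmt_16 {n : ℕ} (L : PerfectSeq n) (A : ℕ → Set ℂ)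
    (hA : ∀ j, A j ⊆ ball (0 : ℂ) 1 \ {0} ∧
      closure (A j) ∩ (ball (0 : ℂ) 1 \ {0}) = A j)
    (hω : Tendsto (fun j => hm 0 (A j)) atTop (𝓝 0))
    (p : ℕ → ℂ → ℂ)
    (hholo : ∀ j, DifferentiableOn ℂ (p j) (ball 0 1))
    (hmaps : ∀ j, MapsTo (p j) (ball 0 1) (ball 0 1 \ A j))
    (hsurj : ∀ j, SurjOn (p j) (ball 0 1) (ball 0 1 \ A j))
    (hcov : ∀ j, IsCoveringMap (Set.MapsTo.restrict (p j) _ _ (hmaps j)))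
    (hp0 : ∀ j, p j 0 = 0)
    (g : ℕ → ℂ → En n) (hg : g = fun j => (L.f j) ∘ (p j)) :
    (∀ z ∈ clusterSet g, TotallyEssential g z) ∧
    WeakConv (fun j => bmeas (g j)) L.μL ∧
    Tendsto (fun j => g j 0) atTop (𝓝 L.zL) ∧
    clusterSet g = clusterSet L.f := by
  subst hg
  have hp : ∀ j, IsDiskCover (A j) (p j) := fun j => ⟨hholo j, hmaps j, hsurj j, hcov j, hp0 j⟩
  have hsub : clusterSet (fun j => L.f j ∘ p j) ⊆ clusterSet L.f := fun z hz r hr N => by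
    obtain ⟨j, hj, ζ, hζ, h⟩ := hz r hr N
    exact ⟨j, hj, p j ζ, (hp j).mapsTo_ball hζ, h⟩
  refine ⟨fun z hz V hV hzV => ?_, fun φ => ?_, ?_, hsub.antisymm fun z hz r hr N => ?_⟩
  · obtain ⟨c, hc0, hc⟩ := exists_between (L.ess z (hsub hz) V hV hzV)
    refine (half_pos hc0).trans_le (le_liminf_of_le (isCoboundedUnder_ge_hm _ _) ?_)
    have hω' : ∀ᶠ j in atTop, 10 * hm 0 (A j) < c / 2 := by
      have := hω.const_mul 10
      rw [mul_zero] at this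
      exact this.eventually_lt_const (half_pos hc0)
    filter_upwards [eventually_lt_of_lt_liminf hc (isBoundedUnder_ge_hm _ _), hω'] with j h1 h2
    have h3 := (hp j).hm_le (fun x hx => ((hA j).1 hx).1)
      (inter_subset_right : L.f j ⁻¹' V ∩ ball 0 1 ⊆ ball 0 1)
    have h4 : p j ⁻¹' (L.f j ⁻¹' V ∩ ball 0 1) ∩ ball 0 1 = (L.f j ∘ p j) ⁻¹' V ∩ ball 0 1 := by
      ext x
      exact ⟨fun h => ⟨h.1.1, h.2⟩, fun h => ⟨⟨h.1, (hp j).mapsTo_ball h.2⟩, h.2⟩⟩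
    rw [h4] at h3
    linarith
  · obtain ⟨C, hC⟩ := L.bdd
    have hdiff : Tendsto (fun j => ∫ x, φ x ∂(bmeas (L.f j ∘ p j)) - ∫ x, φ x ∂(bmeas (L.f j)))
        atTop (𝓝 0) := by
      refine squeeze_zero_norm (fun j =>
        (hp j).abs_integral_bmeas_comp_sub_le (L.holo j) (hC j) φ) ?_
      have := hω.const_mul (10 * ‖φ‖)
      rwa [mul_zero] at this
    simpa using hdiff.add (L.conv φ)
  · exact L.center.congr fun j => by simp [hp0]
  · by_contra! hcon
    obtain ⟨c, hc0, hc⟩ := exists_between (L.ess z hz (ball z r) isOpen_ball (mem_ball_self hr))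
    obtain ⟨j, h1, h2, h3⟩ := ((eventually_lt_of_lt_liminf hc (isBoundedUnder_ge_hm _ _)).and
      ((hω.eventually_lt_const hc0).and (eventually_ge_atTop N))).exists
    have h4 := hm_mono ((hp j).preimage_subset_of_comp_notMem (hcon j h3))
    linarith
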